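/- arXiv:2511.05907 — 4 statements merged into one kernel-verified Lean document; each statement's English description precedes it below -/
import Mathlib

section
/- For c > 0 and Re(ν) > 0, the modified Bessel function of the first kind has the integral representation I_ν(z) = (z/2)^ν/(2πi) ∫_{c−i∞}^{c+i∞} t^{−ν−1} e^{t + z²/(4t)} dt. -/
open Complex MeasureTheory

/-- The modified Bessel function of the first kind,
`I_ν(z) = ∑_{m≥0} (z/2)^{2m+ν} / (m! Γ(m+ν+1))`. -/
noncomputable def besselI (ν z : ℂ) : ℂ :=
  ∑' m : ℕ, (z / 2) ^ (2 * (m : ℂ) + ν) / ((m.factorial : ℂ) * Complex.Gamma ((m : ℂ) + ν + 1))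

lemma laplace_cpow_real_bound (a : ℂ) (ha : 0 < a.re) (c : ℝ) (hc : 0 < c) :
    IntegrableOn (fun x : ℝ => x ^ (a.re - 1) * Real.exp (-c * x)) (Set.Ioi 0) := by
  have h := integrableOn_rpow_mul_exp_neg_mul_rpow (p := 1) (s := a.re - 1) (b := c)
      (by linarith) one_pos hc
  simpa using h

lemma laplace_meas (a r : ℂ) :
    AEStronglyMeasurable (fun x : ℝ => (x : ℂ) ^ (a - 1) * Complex.exp (-(r * x)))
      (volume.restrict (Set.Ioi 0)) := by
  refine ContinuousOn.aestronglyMeasurable ?_ measurableSet_Ioi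
  refine ContinuousOn.mul ?_ (by fun_prop)
  intro x hx
  refine ContinuousAt.continuousWithinAt ?_
  exact Complex.continuousAt_ofReal_cpow_const _ _ (Or.inr (ne_of_gt hx))

lemma laplace_integrable (a : ℂ) (ha : 0 < a.re) (r : ℂ) (hr : 0 < r.re) :
    IntegrableOn (fun x : ℝ => (x : ℂ) ^ (a - 1) * Complex.exp (-(r * x))) (Set.Ioi 0) := by
  refine Integrable.mono' (laplace_cpow_real_bound a ha r.re hr) (laplace_meas a r) ?_
  filter_upwards [ae_restrict_mem measurableSet_Ioi] with x hx
  rw [norm_mul, Complex.norm_cpow_eq_rpow_re_of_pos hx, Complex.norm_exp]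
  simp

lemma laplace_differentiableAt (a : ℂ) (ha : 0 < a.re) (r : ℂ) (hr : 0 < r.re) :
    DifferentiableAt ℂ (fun r : ℂ => ∫ x : ℝ in Set.Ioi 0,
      (x : ℂ) ^ (a - 1) * Complex.exp (-(r * x))) r := by
  have hs : {w : ℂ | r.re / 2 < w.re} ∈ nhds r :=
    (isOpen_lt continuous_const Complex.continuous_re).mem_nhds (by simp; linarith)
  have h := hasDerivAt_integral_of_dominated_loc_of_deriv_le (𝕜 := ℂ)
    (μ := volume.restrict (Set.Ioi (0 : ℝ)))
    (F := fun (r : ℂ) (x : ℝ) => (x : ℂ) ^ (a - 1) * Complex.exp (-(r * x)))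
    (F' := fun (r : ℂ) (x : ℝ) => -((x : ℂ) ^ (a + 1 - 1) * Complex.exp (-(r * x))))
    (bound := fun x : ℝ => x ^ ((a + 1).re - 1) * Real.exp (-(r.re / 2) * x))
    hs (Filter.Eventually.of_forall fun w => laplace_meas a w)
    (laplace_integrable a ha r hr) (laplace_meas (a + 1) r).neg ?_
    (laplace_cpow_real_bound (a + 1) (by simp; linarith) (r.re / 2) (by linarith)) ?_
  · exact h.2.differentiableAt
  · filter_upwards [ae_restrict_mem measurableSet_Ioi] with x hx w hw
    have hx' : 0 < x := hx
    have hw' : r.re / 2 < w.re := hw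
    rw [norm_neg, norm_mul, Complex.norm_cpow_eq_rpow_re_of_pos hx, Complex.norm_exp]
    have : (-(w * x)).re ≤ -(r.re / 2) * x := by
      simp; nlinarith
    simp only [Complex.sub_re, Complex.one_re]
    gcongr
  · filter_upwards [ae_restrict_mem measurableSet_Ioi] with x hx w hw
    have hx' : (x : ℂ) ≠ 0 := by exact_mod_cast (ne_of_gt hx)
    have e : (x : ℂ) ^ (a + 1 - 1) = (x : ℂ) ^ (a - 1) * x := by
      rw [show a + 1 - 1 = (a - 1) + 1 by ring, Complex.cpow_add _ _ hx', Complex.cpow_one]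
    have h1 : HasDerivAt (fun w : ℂ => -(w * x)) (-(1 * (x : ℂ))) w :=
      ((hasDerivAt_id w).mul_const (x : ℂ)).neg
    have h2 := (h1.cexp).const_mul ((x : ℂ) ^ (a - 1))
    refine h2.congr_deriv ?_
    rw [e]; ring

lemma laplace_cpow (a : ℂ) (ha : 0 < a.re) (r : ℂ) (hr : 0 < r.re) :
    ∫ x : ℝ in Set.Ioi 0, (x : ℂ) ^ (a - 1) * Complex.exp (-(r * x)) =
      r ^ (-a) * Complex.Gamma a := by
  have hU : IsOpen {w : ℂ | 0 < w.re} := isOpen_lt continuous_const Complex.continuous_re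
  have hf : AnalyticOnNhd ℂ (fun r : ℂ => ∫ x : ℝ in Set.Ioi 0,
      (x : ℂ) ^ (a - 1) * Complex.exp (-(r * x))) {w : ℂ | 0 < w.re} :=
    DifferentiableOn.analyticOnNhd
      (fun w hw => (laplace_differentiableAt a ha w hw).differentiableWithinAt) hU
  have hg : AnalyticOnNhd ℂ (fun r : ℂ => r ^ (-a) * Complex.Gamma a) {w : ℂ | 0 < w.re} := by
    refine DifferentiableOn.analyticOnNhd (fun w hw => ?_) hU
    have : DifferentiableAt ℂ (fun r : ℂ => r ^ (-a)) w :=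
      differentiableAt_id.cpow_const (Or.inl hw)
    exact (this.mul_const _).differentiableWithinAt
  have hc : IsPreconnected {w : ℂ | 0 < w.re} :=
    (convex_halfSpace_re_gt 0).isPreconnected
  refine hf.eqOn_of_preconnected_of_frequently_eq hg hc (z₀ := 1) (by simp) ?_ hr
  have ht : Filter.Tendsto (fun n : ℕ => (((1 + 1 / ((n : ℝ) + 1) : ℝ)) : ℂ)) Filter.atTop
      (nhdsWithin 1 {1}ᶜ) := by
    rw [tendsto_nhdsWithin_iff]
    constructor
    · have h := (tendsto_one_div_add_atTop_nhds_zero_nat (𝕜 := ℝ)).const_add 1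
      have h2 := (Complex.continuous_ofReal.tendsto _).comp h
      simpa [Function.comp_def] using h2
    · refine Filter.Eventually.of_forall fun n => ?_
      have : (1 + 1 / ((n : ℝ) + 1) : ℝ) ≠ 1 := by
        have : 0 < 1 / ((n : ℝ) + 1) := by positivity
        linarith
      simp only [Set.mem_compl_iff, Set.mem_singleton_iff]
      exact_mod_cast this
  refine ht.frequently (Filter.Frequently.of_forall fun n => ?_)
  have hp : 0 < (1 + 1 / ((n : ℝ) + 1) : ℝ) := by positivity
  have h := Complex.integral_cpow_mul_exp_neg_mul_Ioi ha hp
  rw [h, one_div, Complex.inv_cpow, ← Complex.cpow_neg]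
  rw [Complex.arg_ofReal_of_nonneg hp.le]
  exact Real.pi_ne_zero.symm

lemma line_ne (c : ℝ) (hc : 0 < c) (y : ℝ) : ((c : ℂ) + Complex.I * y) ∈ Complex.slitPlane := by
  left; simpa using hc

lemma line_norm_ge (c : ℝ) (hc : 0 < c) (y : ℝ) : c ≤ ‖(c : ℂ) + Complex.I * y‖ := by
  have := Complex.re_le_norm ((c : ℂ) + Complex.I * y)
  simpa using this

lemma line_cpow_cont (c : ℝ) (hc : 0 < c) (s : ℂ) :
    Continuous fun y : ℝ => ((c : ℂ) + Complex.I * y) ^ s := by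
  refine Continuous.cpow (by fun_prop) continuous_const ?_
  intro y; exact line_ne c hc y

lemma line_cpow_integrable (c : ℝ) (hc : 0 < c) (s : ℂ) (hs : 1 < s.re) :
    Integrable fun y : ℝ => ((c : ℂ) + Complex.I * y) ^ (-s) := by
  have h0 : Integrable (fun y : ℝ => (1 + ‖y‖ ^ 2) ^ (-s.re / 2)) :=
    integrable_rpow_neg_one_add_norm_sq (by simpa using hs)
  have h1 := h0.const_mul ((min c 1 ^ 2) ^ (-s.re / 2) * Real.exp (Real.pi * |s.im|))
  refine h1.mono' (line_cpow_cont c hc _).aestronglyMeasurable (Filter.Eventually.of_forall ?_)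
  intro y
  have hk : 0 < min c 1 := lt_min hc one_pos
  have hN : ‖(c : ℂ) + Complex.I * y‖ ^ 2 = c ^ 2 + y ^ 2 := by
    rw [← Complex.normSq_eq_norm_sq, Complex.normSq_apply]; simp; ring
  have hge : min c 1 ^ 2 * (1 + ‖y‖ ^ 2) ≤ ‖(c : ℂ) + Complex.I * y‖ ^ 2 := by
    rw [hN, Real.norm_eq_abs, sq_abs]
    have a1 : min c 1 ^ 2 ≤ c ^ 2 := pow_le_pow_left₀ hk.le (min_le_left _ _) 2
    have a2 : min c 1 ^ 2 ≤ 1 := pow_le_one₀ hk.le (min_le_right _ _)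
    nlinarith [sq_nonneg y]
  have e1 : ‖(c : ℂ) + Complex.I * y‖ ^ (-s).re ≤
      (min c 1 ^ 2) ^ (-s.re / 2) * (1 + ‖y‖ ^ 2) ^ (-s.re / 2) := by
    rw [← Real.mul_rpow (by positivity) (by positivity)]
    have : ‖(c : ℂ) + Complex.I * y‖ ^ (-s).re = (‖(c : ℂ) + Complex.I * y‖ ^ 2) ^ (-s.re / 2) := by
      rw [← Real.rpow_natCast, ← Real.rpow_mul (norm_nonneg _)]
      congr 1; simp; ring
    rw [this]
    exact Real.rpow_le_rpow_of_nonpos (by positivity) hge (by linarith)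
  have e2 : (Real.exp (((c : ℂ) + Complex.I * y).arg * (-s).im))⁻¹ ≤
      Real.exp (Real.pi * |s.im|) := by
    rw [← Real.exp_neg, Real.exp_le_exp]
    calc _ ≤ |-(((c : ℂ) + Complex.I * y).arg * (-s).im)| := le_abs_self _
      _ = |((c : ℂ) + Complex.I * y).arg| * |s.im| := by simp [abs_mul]
      _ ≤ _ := mul_le_mul_of_nonneg_right (Complex.abs_arg_le_pi _) (abs_nonneg _)
  calc _ ≤ _ := Complex.norm_cpow_le _ _
    _ ≤ ((min c 1 ^ 2) ^ (-s.re / 2) * (1 + ‖y‖ ^ 2) ^ (-s.re / 2)) * Real.exp (Real.pi * |s.im|) := by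
      rw [div_eq_mul_inv]
      exact mul_le_mul e1 e2 (by positivity) (by positivity)
    _ = _ := by ring

lemma gamma_line (c : ℝ) (hc : 0 < c) (s : ℂ) (hs : 1 < s.re) :
    ∫ y : ℝ, ((c : ℂ) + Complex.I * y) ^ (-s) * Complex.exp ((c : ℂ) + Complex.I * y) =
      2 * Real.pi / Complex.Gamma s := by
  have hs1 : s - 1 ≠ 0 := by
    intro h; have := congrArg Complex.re h; simp at this; linarith
  have hG : Complex.Gamma s ≠ 0 := Complex.Gamma_ne_zero_of_re_pos (by linarith)
  let f : ℝ → ℂ := fun x => ((max x 0 : ℝ) : ℂ) ^ (s - 1) * Complex.exp (-((c : ℂ) * x))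
  have hfi : f = Set.indicator (Set.Ioi 0)
      (fun x : ℝ => (x : ℂ) ^ (s - 1) * Complex.exp (-((c : ℂ) * x))) := by
    funext x
    by_cases hx : 0 < x
    · rw [Set.indicator_of_mem (by exact hx)]; simp [f, max_eq_left hx.le]
    · rw [Set.indicator_of_notMem (by exact hx)]
      simp [f, max_eq_right (not_lt.mp hx), Complex.zero_cpow hs1]
  have hfc : Continuous f := by
    refine Continuous.mul ?_ (by fun_prop)
    exact (Complex.continuous_ofReal_cpow_const (by simp; linarith)).comp
      (continuous_id.max continuous_const)
  have hfint : Integrable f := by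
    rw [hfi, integrable_indicator_iff measurableSet_Ioi]
    have h := integrableOn_rpow_mul_exp_neg_mul_rpow (p := 1) (s := s.re - 1) (b := c)
      (by linarith) one_pos hc
    have hm : AEStronglyMeasurable f (volume.restrict (Set.Ioi 0)) := hfc.aestronglyMeasurable
    rw [hfi] at hm
    have hm' : AEStronglyMeasurable (fun x : ℝ => (x : ℂ) ^ (s - 1) * Complex.exp (-((c : ℂ) * x)))
        (volume.restrict (Set.Ioi 0)) :=
      hm.congr (indicator_ae_eq_restrict measurableSet_Ioi)
    refine Integrable.mono' h hm' ?_
    filter_upwards [ae_restrict_mem measurableSet_Ioi] with x hx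
    rw [norm_mul, Complex.norm_cpow_eq_rpow_re_of_pos hx, Complex.norm_exp]
    simp
  have hF : FourierTransform.fourier f = fun w : ℝ =>
      Complex.Gamma s * ((c : ℂ) + Complex.I * ((2 * Real.pi * w : ℝ) : ℂ)) ^ (-s) := by
    funext w
    rw [Real.fourier_real_eq_integral_exp_smul]
    have h := laplace_cpow s (by linarith) ((c : ℂ) + Complex.I * ((2 * Real.pi * w : ℝ) : ℂ))
      (by simpa using hc)
    rw [mul_comm (Complex.Gamma s), ← h, ← integral_indicator measurableSet_Ioi]
    congr 1
    funext x
    rw [hfi]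
    by_cases hx : x ∈ Set.Ioi (0 : ℝ)
    · rw [Set.indicator_of_mem hx, Set.indicator_of_mem hx, smul_eq_mul, mul_left_comm,
        ← Complex.exp_add]
      congr 2; push_cast; ring
    · rw [Set.indicator_of_notMem hx, Set.indicator_of_notMem hx, smul_zero]
  have hFint : Integrable (FourierTransform.fourier f) := by
    rw [hF]
    exact ((line_cpow_integrable c hc s hs).comp_mul_left' (R := 2 * Real.pi)
      (by positivity)).const_mul _
  have key := congrFun (hfc.fourierInv_fourier_eq hfint hFint) 1
  rw [Real.fourierInv_eq', hF] at key
  have hsub := Measure.integral_comp_mul_left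
    (fun y : ℝ => ((c : ℂ) + Complex.I * y) ^ (-s) * Complex.exp ((c : ℂ) + Complex.I * y)) (2 * Real.pi)
  have hL : ∫ v : ℝ, Complex.exp (((2 * Real.pi * inner ℝ v 1 : ℝ) : ℂ) * Complex.I) •
      (Complex.Gamma s * ((c : ℂ) + Complex.I * ((2 * Real.pi * v : ℝ) : ℂ)) ^ (-s)) =
      Complex.Gamma s * Complex.exp (-c) * ∫ x : ℝ, ((c : ℂ) + Complex.I * ((2 * Real.pi * x : ℝ) : ℂ)) ^ (-s) *
        Complex.exp ((c : ℂ) + Complex.I * ((2 * Real.pi * x : ℝ) : ℂ)) := by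
    rw [← integral_const_mul]
    congr 1
    funext v
    have : Complex.exp (((2 * Real.pi * inner ℝ v 1 : ℝ) : ℂ) * Complex.I) = Complex.exp (-c) *
        Complex.exp ((c : ℂ) + Complex.I * ((2 * Real.pi * v : ℝ) : ℂ)) := by
      rw [← Complex.exp_add]; congr 1; simp; ring
    rw [this, smul_eq_mul]; ring
  rw [hL, hsub] at key
  have hf1 : f 1 = Complex.exp (-c) := by simp [f]
  rw [hf1] at key
  have hE := Complex.exp_ne_zero (-(c : ℂ))
  have hpi : (Real.pi : ℂ) ≠ 0 := by exact_mod_cast Real.pi_ne_zero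
  rw [abs_of_pos (by positivity), Complex.real_smul] at key
  push_cast at key
  rw [eq_div_iff hG]
  generalize (∫ y : ℝ, ((c : ℂ) + Complex.I * y) ^ (-s) * Complex.exp ((c : ℂ) + Complex.I * y)) = J at key ⊢
  have : Complex.exp (-(c : ℂ)) * (Complex.Gamma s * ((2 * Real.pi : ℂ)⁻¹ * J)) =
      Complex.exp (-(c : ℂ)) * 1 := by linear_combination key
  have := mul_left_cancel₀ hE this
  field_simp at this
  linear_combination this

/-- For `c > 0` and `Re ν > 0`, the vertical-line integral representation
`I_ν(z) = (z/2)^ν/(2πi) ∫_{c−i∞}^{c+i∞} t^{−ν−1} e^{t + z²/(4t)} dt`,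
where the line `Re t = c` is parametrized as `t = c + iy`, `y ∈ ℝ`,
so that `dt = i dy`. -/
theorem besselI_integral_rep (ν z : ℂ) (c : ℝ) (hc : 0 < c) (hν : 0 < ν.re) :
    besselI ν z = (z / 2) ^ ν / (2 * (Real.pi : ℂ) * Complex.I) *
      (Complex.I * ∫ y : ℝ,
        ((c : ℂ) + Complex.I * y) ^ (-ν - 1) *
          Complex.exp (((c : ℂ) + Complex.I * y) + z ^ 2 / (4 * ((c : ℂ) + Complex.I * y)))) := by
  rcases eq_or_ne z 0 with rfl | hz
  · have h0 : ν ≠ 0 := by rintro rfl; simp at hν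
    have h1 : ∀ m : ℕ, 2 * (m : ℂ) + ν ≠ 0 := by
      intro m h
      have := congrArg Complex.re h
      simp at this
      have : (0 : ℝ) ≤ m := by positivity
      linarith
    simp [besselI, Complex.zero_cpow h0, Complex.zero_cpow (h1 _)]
  set T : ℝ → ℂ := fun y => (c : ℂ) + Complex.I * y with hT
  have hT0 : ∀ y, T y ≠ 0 := fun y => Complex.slitPlane_ne_zero (line_ne c hc y)
  have hTc : Continuous T := by fun_prop
  have hTn : ∀ y, c ≤ ‖T y‖ := line_norm_ge c hc
  let F : ℕ → ℝ → ℂ := fun m y => T y ^ (-ν - 1) * Complex.exp (T y) *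
    ((z ^ 2 / (4 * T y)) ^ m / (m.factorial : ℂ))
  let G : ℝ → ℝ := fun y => ‖T y ^ (-ν - 1) * Complex.exp (T y)‖
  have hGi : Integrable G := by
    refine Integrable.norm ?_
    have h := line_cpow_integrable c hc (ν + 1) (by simpa using hν)
    have h2 := h.norm.mul_const (Real.exp c)
    refine h2.mono' ((line_cpow_cont c hc _).mul (by fun_prop)).aestronglyMeasurable
      (Filter.Eventually.of_forall fun y => ?_)
    rw [norm_mul, Complex.norm_exp]
    simp [hT, neg_add, sub_eq_add_neg, add_comm]
  have hsum : HasSum (fun m => ∫ y, F m y)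
      (∫ y, T y ^ (-ν - 1) * Complex.exp (T y + z ^ 2 / (4 * T y))) := by
    refine hasSum_integral_of_dominated_convergence
      (fun m y => G y * ((‖z‖ ^ 2 / (4 * c)) ^ m / (m.factorial : ℝ))) ?_ ?_ ?_ ?_ ?_
    · intro m
      refine Continuous.aestronglyMeasurable ?_
      refine ((line_cpow_cont c hc _).mul (by fun_prop)).mul ?_
      refine ((continuous_const.div (by fun_prop) ?_).pow m).div_const _
      intro y; simpa using hT0 y
    · intro m
      refine Filter.Eventually.of_forall fun y => ?_
      simp only [F, G]
      rw [norm_mul]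
      refine mul_le_mul_of_nonneg_left ?_ (norm_nonneg _)
      rw [norm_div, norm_pow, norm_div, norm_pow, norm_mul]
      simp only [Complex.norm_natCast, Complex.norm_ofNat]
      have := hTn y
      gcongr
    · exact Filter.Eventually.of_forall fun y => (Real.summable_pow_div_factorial _).mul_left _
    · simp_rw [tsum_mul_left]
      exact hGi.mul_const _
    · refine Filter.Eventually.of_forall fun y => ?_
      rw [Complex.exp_add, ← mul_assoc]
      refine HasSum.mul_left _ ?_
      have := NormedSpace.expSeries_div_hasSum_exp (z ^ 2 / (4 * T y))
      rwa [← Complex.exp_eq_exp_ℂ] at this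
  have hint : ∀ m : ℕ, ∫ y, F m y = (z / 2) ^ (2 * m) / (m.factorial : ℂ) *
      (2 * Real.pi / Complex.Gamma ((m : ℂ) + ν + 1)) := by
    intro m
    rw [← gamma_line c hc ((m : ℂ) + ν + 1) (by
      have : (0 : ℝ) ≤ m := by positivity
      simp; linarith), ← integral_const_mul]
    congr 1
    funext y
    have e : (T y) ^ (-((m : ℂ) + ν + 1)) = T y ^ (-ν - 1) * ((T y) ^ m)⁻¹ := by
      rw [← Complex.cpow_natCast, ← Complex.cpow_neg, ← Complex.cpow_add _ _ (hT0 y)]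
      congr 1; ring
    change F m y = _ * ((T y) ^ (-((m : ℂ) + ν + 1)) * Complex.exp (T y))
    rw [e]
    simp only [F]
    have h4 : (z / 2) ^ (2 * m) = (z ^ 2 / 4) ^ m := by rw [pow_mul]; congr 1; ring
    have h5 : z ^ 2 / (4 * T y) = z ^ 2 / 4 * (T y)⁻¹ := by
      rw [div_mul_eq_div_div]; rfl
    rw [h4, h5, mul_pow, inv_pow]
    ring
  have hpi : (Real.pi : ℂ) ≠ 0 := by exact_mod_cast Real.pi_ne_zero
  have hfin := hsum.mul_left ((z / 2) ^ ν / (2 * (Real.pi : ℂ) * Complex.I) * Complex.I)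
  rw [besselI, ← mul_assoc]
  refine Eq.trans ?_ hfin.tsum_eq
  congr 1
  funext m
  rw [hint, Complex.cpow_add _ _ (div_ne_zero hz two_ne_zero)]
  have : (z / 2) ^ (2 * (m : ℂ)) = (z / 2) ^ (2 * m) := by
    rw [← Complex.cpow_natCast]; push_cast; rfl
  rw [this]
  have hI := Complex.I_ne_zero
  have hm : (m.factorial : ℂ) ≠ 0 := by exact_mod_cast m.factorial_ne_zero
  have hG : Complex.Gamma ((m : ℂ) + ν + 1) ≠ 0 := by
    refine Complex.Gamma_ne_zero_of_re_pos ?_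
    have : (0 : ℝ) ≤ m := by positivity
    simp; linarith
  field_simp
end

section
/- Let ε(a,b,c,d) = exp(iπ Φ[a,b;c,d]/12) where for c > 0, Φ[a,b;c,d] = (a+d)/c − 12·s(d,c), with s the Dedekind sum. Then for τ in the upper half plane and [a,b;c,d] ∈ SL₂(ℤ) with c > 0, the Dedekind eta function satisfies η((aτ+b)/(cτ+d)) = ε(a,b,c,d) · √((cτ+d)/i) · η(τ). -/
open Finset Complex

/-- The Dedekind sum `s(h,k) = ∑_{r=1}^{k-1} (r/k)·(hr/k − ⌊hr/k⌋ − 1/2)`. -/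
noncomputable def dedekindSum (h : ℤ) (k : ℕ) : ℝ :=
  ∑ r ∈ Finset.Ico 1 k, ((r : ℝ) / k) *
    (((h * r : ℤ) : ℝ) / k - ⌊((h * r : ℤ) : ℝ) / k⌋ - 1 / 2)

/-- The Dedekind eta function `η(τ) = e^{iπτ/12} ∏_{m≥1}(1 − e^{2πimτ})`. -/
noncomputable def dedekindEta (τ : ℂ) : ℂ :=
  Complex.exp ((Real.pi : ℂ) * Complex.I * τ / 12) *
    ∏' m : ℕ, (1 - Complex.exp (2 * (Real.pi : ℂ) * Complex.I * ((m : ℂ) + 1) * τ))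

lemma perm_sum (h k : ℕ) (hk : Nat.Coprime h k) (g : ℕ → ℤ) :
    ∑ r ∈ Ico 1 k, g (h * r % k) = ∑ r ∈ Ico 1 k, g r := by
  have hinj : Set.InjOn (fun r => h * r % k) (Ico 1 k : Finset ℕ) := by
    intro x hx y hy hxy
    simp only [coe_Ico, Set.mem_Ico] at hx hy
    have h1 : x ≡ y [MOD k] := Nat.ModEq.cancel_left_of_coprime (Nat.Coprime.symm hk) hxy
    exact Nat.ModEq.eq_of_lt_of_lt h1 hx.2 hy.2
  rw [← Finset.sum_image (f := g) hinj]
  congr 1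
  apply Finset.eq_of_subset_of_card_le
  · intro x hx
    simp only [mem_image, mem_Ico] at hx ⊢
    obtain ⟨r, hr, rfl⟩ := hx
    refine ⟨?_, Nat.mod_lt _ (by omega)⟩
    rw [Nat.one_le_iff_ne_zero]
    intro h0
    have := (Nat.Coprime.dvd_of_dvd_mul_left hk.symm (Nat.dvd_of_mod_eq_zero h0))
    have := Nat.le_of_dvd (by omega) this
    omega
  · rw [Finset.card_image_of_injOn hinj]

lemma sum_id1 (k : ℕ) (hk : 1 ≤ k) : 2 * ∑ r ∈ Ico 1 k, (r : ℤ) = k * (k - 1) := by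
  induction k, hk using Nat.le_induction with
  | base => simp
  | succ n hn ih => rw [Finset.sum_Ico_succ_top hn, mul_add, ih]; push_cast; ring

lemma sum_id2 (k : ℕ) (hk : 1 ≤ k) : 6 * ∑ r ∈ Ico 1 k, (r : ℤ)^2 = k * (k - 1) * (2 * k - 1) := by
  induction k, hk using Nat.le_induction with
  | base => simp
  | succ n hn ih => rw [Finset.sum_Ico_succ_top hn, mul_add, ih]; push_cast; ring

lemma sum_odd (k : ℕ) : ∑ s ∈ Ico 1 (k + 1), (2 * (s : ℤ) - 1) = (k : ℤ)^2 := by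
  induction k with
  | zero => simp
  | succ n ih => rw [Finset.sum_Ico_succ_top (by omega), ih]; push_cast; ring

lemma dm (h k r : ℕ) : (h : ℤ) * r = k * ((h * r / k : ℕ) : ℤ) + ((h * r % k : ℕ) : ℤ) := by
  exact_mod_cast (Nat.div_add_mod (h * r) k).symm

lemma sum_f (h k : ℕ) (hk : Nat.Coprime h k) (hk1 : 1 ≤ k) :
    2 * ∑ r ∈ Ico 1 k, ((h * r / k : ℕ) : ℤ) = (h - 1) * (k - 1) := by
  have h1 := perm_sum h k hk (fun x => (x : ℤ))
  have h2 : (h : ℤ) * ∑ r ∈ Ico 1 k, (r : ℤ) = k * ∑ r ∈ Ico 1 k, ((h * r / k : ℕ) : ℤ)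
      + ∑ r ∈ Ico 1 k, ((h * r % k : ℕ) : ℤ) := by
    rw [mul_sum, mul_sum, ← sum_add_distrib]
    exact sum_congr rfl fun r _ => dm h k r
  have h3 := sum_id1 k hk1
  have hk0 : (k : ℤ) ≠ 0 := by positivity
  apply mul_left_cancel₀ hk0
  rw [h1] at h2
  linear_combination (-2) * h2 + (h - 1) * h3

lemma sum_f2 (h k : ℕ) (hk : Nat.Coprime h k) :
    (h : ℤ)^2 * ∑ r ∈ Ico 1 k, (r : ℤ)^2 - 2 * h * k * ∑ r ∈ Ico 1 k, (r : ℤ) * ((h * r / k : ℕ) : ℤ)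
      + k^2 * ∑ r ∈ Ico 1 k, ((h * r / k : ℕ) : ℤ)^2 = ∑ r ∈ Ico 1 k, (r : ℤ)^2 := by
  have h1 := perm_sum h k hk (fun x => (x : ℤ)^2)
  refine Eq.trans ?_ h1
  rw [mul_sum, mul_sum, mul_sum, ← sum_sub_distrib, ← sum_add_distrib]
  refine sum_congr rfl fun r _ => ?_
  have : ((h * r % k : ℕ) : ℤ) = h * r - k * ((h * r / k : ℕ) : ℤ) := by
    linarith [dm h k r]
  simp only [this]; ring

lemma cop_ne (h k r s : ℕ) (hk : Nat.Coprime h k) (hr : 1 ≤ r) (hr' : r < k) : k * s ≠ h * r := by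
  intro e
  have := (Nat.Coprime.dvd_of_dvd_mul_left hk.symm (Dvd.intro _ e))
  have := Nat.le_of_dvd (by omega) this
  omega

lemma sum_sq (h k : ℕ) (hk : Nat.Coprime h k) (hk1 : 1 ≤ k) (hh1 : 1 ≤ h) :
    ∑ r ∈ Ico 1 k, ((h * r / k : ℕ) : ℤ)^2 =
      ∑ s ∈ Ico 1 h, (2 * (s : ℤ) - 1) * (k - 1 - ((k * s / h : ℕ) : ℤ)) := by
  have e1 : ∀ r ∈ Ico 1 k, ((h * r / k : ℕ) : ℤ)^2 =
      ∑ s ∈ Ico 1 h, if k * s < h * r then (2 * (s : ℤ) - 1) else 0 := by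
    intro r hr
    rw [mem_Ico] at hr
    rw [← sum_odd, ← sum_filter]
    congr 1
    ext s
    simp only [mem_filter, mem_Ico, Nat.lt_succ_iff]
    rw [Nat.le_div_iff_mul_le (by omega), mul_comm s k]
    have := cop_ne h k r s hk hr.1 hr.2
    constructor
    · rintro ⟨h1, h2⟩
      refine ⟨⟨h1, ?_⟩, by omega⟩
      by_contra hcon
      push Not at hcon
      nlinarith
    · rintro ⟨⟨h1, h2⟩, h3⟩
      exact ⟨h1, by omega⟩
  have e2 : ∀ s ∈ Ico 1 h, (k - 1 - ((k * s / h : ℕ) : ℤ)) =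
      ∑ r ∈ Ico 1 k, if k * s < h * r then (1 : ℤ) else 0 := by
    intro s hs
    rw [mem_Ico] at hs
    rw [← sum_filter]
    have : filter (fun r => k * s < h * r) (Ico 1 k) = Ico (k * s / h + 1) k := by
      ext r
      simp only [mem_filter, mem_Ico, Nat.succ_le_iff]
      rw [Nat.div_lt_iff_lt_mul (by omega), mul_comm r h]
      constructor
      · rintro ⟨h1, h2⟩
        exact ⟨h2, h1.2⟩
      · rintro ⟨h1, h2⟩
        refine ⟨⟨?_, h2⟩, h1⟩
        by_contra hcon
        have : r = 0 := by omega
        subst this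
        simp at h1
    rw [this]
    have hlt : k * s / h < k := by
      rw [Nat.div_lt_iff_lt_mul (by omega)]
      exact Nat.mul_lt_mul_of_pos_left hs.2 (by omega)
    simp only [sum_const, Nat.card_Ico, nsmul_eq_mul, mul_one]
    omega
  rw [sum_congr rfl e1, sum_comm]
  refine sum_congr rfl fun s hs => ?_
  rw [e2 s hs, mul_sum]
  simp

lemma recip_int (h k : ℕ) (hk : Nat.Coprime h k) (hk1 : 1 ≤ k) (hh1 : 1 ≤ h) :
    12 * (h * ∑ r ∈ Ico 1 k, (r : ℤ) * ((h * r / k : ℕ) : ℤ) +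
     k * ∑ r ∈ Ico 1 h, (r : ℤ) * ((k * r / h : ℕ) : ℤ)) * k = 
     (h^2 - 1) * (k * (k - 1) * (2 * k - 1)) + 6 * k^2 * (k-1)*(h-1)^2 + 3 * k^2 * (k-1)*(h-1) := by
  have h1 := sum_f2 h k hk
  have h2 := sum_sq h k hk hk1 hh1
  have h3 := sum_f k h hk.symm hh1
  have h4 := sum_id2 k hk1
  have h5 := sum_id1 h hh1
  have h6 : ∑ s ∈ Ico 1 h, (2 * (s : ℤ) - 1) * (k - 1 - ((k * s / h : ℕ) : ℤ)) =
     2 * (k - 1) * ∑ s ∈ Ico 1 h, (s : ℤ) - (k - 1) * (h - 1) -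
      2 * ∑ r ∈ Ico 1 h, (r : ℤ) * ((k * r / h : ℕ) : ℤ) + ∑ r ∈ Ico 1 h, ((k * r / h : ℕ) : ℤ) := by
    have : ((h : ℤ) - 1) = ∑ s ∈ Ico 1 h, (1 : ℤ) := by simp; omega
    rw [this, mul_sum, mul_sum, mul_sum, ← sum_sub_distrib, ← sum_sub_distrib, ← sum_add_distrib]
    refine sum_congr rfl fun r _ => ?_
    ring
  rw [h6] at h2
  rw [h2] at h1
  linear_combination (-6) * h1 + (h^2-1) * h4 + 6 * k^2*(k-1) * h5 + 3 * k^2 * h3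

lemma ds_nat (h k : ℕ) (hk1 : 1 ≤ k) :
    (dedekindSum h k) = ((h : ℝ) / k^2) * ((∑ r ∈ Ico 1 k, (r : ℤ)^2 : ℤ) : ℝ)
      - ((∑ r ∈ Ico 1 k, (r : ℤ) * ((h * r / k : ℕ) : ℤ) : ℤ) : ℝ) / k
      - ((∑ r ∈ Ico 1 k, (r : ℤ) : ℤ) : ℝ) / (2 * k) := by
  have hk0 : (k : ℝ) ≠ 0 := by positivity
  unfold dedekindSum
  push_cast
  rw [mul_sum, sum_div, sum_div, ← sum_sub_distrib, ← sum_sub_distrib]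
  refine sum_congr rfl fun r _ => ?_
  have : ⌊((h : ℝ) * r) / k⌋ = ((h * r / k : ℕ) : ℤ) := by
    rw [Int.floor_div_natCast]
    have : ((h : ℝ) * r) = ((h * r : ℕ) : ℝ) := by push_cast; ring
    rw [this, Int.floor_natCast]
    push_cast; ring
  rw [this]
  push_cast
  field_simp
  

lemma reciprocity (h k : ℕ) (hk : Nat.Coprime h k) (hk1 : 1 ≤ k) (hh1 : 1 ≤ h) :
    12 * dedekindSum h k + 12 * dedekindSum k h =
      (h : ℝ) / k + (k : ℝ) / h + 1 / (h * k) - 3 := by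
  have hk0 : (k : ℝ) ≠ 0 := by positivity
  have hh0 : (h : ℝ) ≠ 0 := by positivity
  rw [ds_nat h k hk1, ds_nat k h hh1]
  have h1 := congrArg (Int.cast (R := ℝ)) (recip_int h k hk hk1 hh1)
  have h2 := congrArg (Int.cast (R := ℝ)) (sum_id1 h hh1)
  have h3 := congrArg (Int.cast (R := ℝ)) (sum_id1 k hk1)
  have h4 := congrArg (Int.cast (R := ℝ)) (sum_id2 h hh1)
  have h5 := congrArg (Int.cast (R := ℝ)) (sum_id2 k hk1)
  rw [Int.cast_mul] at h2 h3 h4 h5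
  rw [Int.cast_mul, Int.cast_mul, Int.cast_add, Int.cast_mul, Int.cast_mul] at h1
  generalize ((∑ r ∈ Ico 1 k, (r : ℤ) * ((h * r / k : ℕ) : ℤ) : ℤ) : ℝ) = A at *
  generalize ((∑ r ∈ Ico 1 h, (r : ℤ) * ((k * r / h : ℕ) : ℤ) : ℤ) : ℝ) = B at *
  generalize ((∑ r ∈ Ico 1 k, (r : ℤ) : ℤ) : ℝ) = C at *
  generalize ((∑ r ∈ Ico 1 h, (r : ℤ) : ℤ) : ℝ) = D at *
  generalize ((∑ r ∈ Ico 1 k, (r : ℤ)^2 : ℤ) : ℝ) = E at *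
  generalize ((∑ r ∈ Ico 1 h, (r : ℤ)^2 : ℤ) : ℝ) = F at *
  push_cast at *
  have hD : D = h * (h - 1) / 2 := by linarith
  have hC : C = k * (k - 1) / 2 := by linarith
  have hF : F = h * (h - 1) * (2 * h - 1) / 6 := by linarith
  have hE : E = k * (k - 1) * (2 * k - 1) / 6 := by linarith
  have hA : A = (((h^2 - 1) * (k * (k - 1) * (2 * k - 1)) + 6 * k^2 * (k-1)*(h-1)^2
     + 3 * k^2 * (k-1)*(h-1)) / (12 * k) - k * B) / h := by
    field_simp
    apply mul_left_cancel₀ hk0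
    linear_combination h1
  subst hD hC hF hE hA
  field_simp
  ring

lemma ds_fract (d : ℤ) (k : ℕ) : dedekindSum d k =
    ∑ r ∈ Ico 1 k, ((r : ℝ) / k) * (Int.fract (((d * r : ℤ) : ℝ) / k) - 1 / 2) := rfl

lemma ds_add (d n : ℤ) (k : ℕ) (hk1 : 1 ≤ k) : dedekindSum (d + n * k) k = dedekindSum d k := by
  have hk0 : (k : ℝ) ≠ 0 := by positivity
  rw [ds_fract, ds_fract]
  refine sum_congr rfl fun r _ => ?_
  have : (((d + n * k) * r : ℤ) : ℝ) / k = ((d * r : ℤ) : ℝ) / k + ((n * r : ℤ) : ℝ) := by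
    push_cast
    field_simp
  rw [this, Int.fract_add_intCast]

lemma ds_neg (d k : ℕ) (hk : Nat.Coprime d k) : dedekindSum (-d) k = - dedekindSum d k := by
  rw [ds_fract, ds_fract, ← sum_neg_distrib]
  refine sum_congr rfl fun r hr => ?_
  rw [mem_Ico] at hr
  have hk0 : (k : ℝ) ≠ 0 := by
    have : k ≠ 0 := by omega
    exact_mod_cast this
  have : (((-d : ℤ) * r : ℤ) : ℝ) / k = -(((d * r : ℤ) : ℝ) / k) := by
    push_cast
    ring
  rw [this, Int.fract_neg]
  · ring
  · rw [Ne, Int.fract_eq_zero_iff]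
    rintro ⟨m, hm⟩
    rw [eq_div_iff hk0] at hm
    have hm' : m * (k : ℤ) = d * r := by exact_mod_cast hm
    have hd : (k : ℤ) ∣ ((d * r : ℕ) : ℤ) := ⟨m, by push_cast; linarith⟩
    have := (Nat.Coprime.dvd_of_dvd_mul_left hk.symm (Int.natCast_dvd_natCast.mp hd))
    have := Nat.le_of_dvd (by omega) this
    omega

lemma eta_eq (τ : ℂ) : dedekindEta τ = ModularForm.eta τ := by
  unfold dedekindEta ModularForm.eta
  congr 1
  · simp only [Function.Periodic.qParam]
    congr 1
    push_cast
    ring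
  · simp_rw [ModularForm.eta_q_eq_cexp]

lemma eta_add (τ : ℂ) (n : ℤ) :
    dedekindEta (τ + n) = Complex.exp (Real.pi * Complex.I / 12 * n) * dedekindEta τ := by
  unfold dedekindEta
  rw [← mul_assoc, ← Complex.exp_add]
  congr 1
  · congr 1
    ring
  · congr 1
    ext m
    congr 1
    have : 2 * (Real.pi : ℂ) * I * ((m : ℂ) + 1) * (τ + n) =
      2 * (Real.pi : ℂ) * I * ((m : ℂ) + 1) * τ + (((m + 1) * n : ℤ) : ℂ) * (2 * Real.pi * I) := by
      push_cast; ring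
    rw [this, Complex.exp_add, Complex.exp_int_mul_two_pi_mul_I, mul_one]

lemma cpow_mul_half (x y : ℂ) (hx : 0 < x.re) (hy : 0 < y.re) :
    x ^ ((1 : ℂ) / 2) * y ^ ((1 : ℂ) / 2) = (x * y) ^ ((1 : ℂ) / 2) := by
  have hx0 : x ≠ 0 := by rintro rfl; simp at hx
  have hy0 : y ≠ 0 := by rintro rfl; simp at hy
  have h1 := abs_lt.mp (Complex.abs_arg_lt_pi_div_two_iff.mpr (Or.inl hx))
  have h2 := abs_lt.mp (Complex.abs_arg_lt_pi_div_two_iff.mpr (Or.inl hy))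
  rw [cpow_def_of_ne_zero hx0, cpow_def_of_ne_zero hy0, cpow_def_of_ne_zero (mul_ne_zero hx0 hy0),
    Complex.log_mul hx0 hy0 ⟨by linarith, by linarith⟩, ← Complex.exp_add]
  congr 1
  ring

lemma cpow_div_I (z : ℂ) (hz : 0 < z.im) :
    z ^ ((1 : ℂ) / 2) = Complex.exp (Real.pi * Complex.I / 12 * 3) * (z / I) ^ ((1 : ℂ) / 2) := by
  have hz0 : z ≠ 0 := by rintro rfl; simp at hz
  have h0 : z / I ≠ 0 := div_ne_zero hz0 I_ne_zero
  have hre : 0 < (z / I).re := by simpa [Complex.div_re] using hz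
  have h1 := abs_lt.mp (Complex.abs_arg_lt_pi_div_two_iff.mpr (Or.inl hre))
  have h2 := Real.pi_pos
  have : z = (z / I) * I := by field_simp
  conv_lhs => rw [this]
  rw [cpow_def_of_ne_zero h0, cpow_def_of_ne_zero (mul_ne_zero h0 I_ne_zero),
    Complex.log_mul h0 I_ne_zero (by rw [arg_I]; exact ⟨by linarith, by linarith⟩),
    ← Complex.exp_add, log_I]
  congr 1
  ring

lemma eta_S (τ : ℂ) (hτ : 0 < τ.im) :
    dedekindEta (-1 / τ) = (τ / I) ^ ((1 : ℂ) / 2) * dedekindEta τ := by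
  rw [eta_eq, eta_eq]
  have h := ModularForm.eta_comp_eq_csqrt_I_inv (x := τ) hτ
  simp only [Function.comp, Pi.smul_apply, Pi.mul_apply, smul_eq_mul, Complex.sqrt] at h
  rw [h]
  have h3 := cpow_div_I τ hτ
  have h4 := cpow_div_I I (by simp)
  rw [div_self I_ne_zero, one_cpow] at h4
  rw [one_div] at h3 h4 ⊢
  rw [h3, h4]
  have := Complex.exp_ne_zero (Real.pi * Complex.I / 12 * 3)
  field_simp

lemma eta_main (c : ℕ) : 1 ≤ c → ∀ (a b d : ℤ), a * d - b * c = 1 → ∀ τ : ℂ, 0 < τ.im →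
    dedekindEta (((a : ℂ) * τ + b) / ((c : ℂ) * τ + d)) =
      Complex.exp ((Real.pi : ℂ) * Complex.I / 12 *
          (((a : ℂ) + (d : ℂ)) / (c : ℂ) - 12 * ((dedekindSum d c : ℝ) : ℂ))) *
        (((c : ℂ) * τ + (d : ℂ)) / Complex.I) ^ ((1 : ℂ) / 2) * dedekindEta τ := by
  induction c using Nat.strong_induction_on with
  | _ c ih =>
  intro hc a b d hdet τ hτ
  have hc0 : (c : ℂ) ≠ 0 := by
    have : c ≠ 0 := by omega
    exact_mod_cast this
  rcases Nat.eq_or_lt_of_le hc with h1 | h1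
  · subst h1
    have hb : b = a * d - 1 := by push_cast at hdet; linarith
    have him : 0 < (τ + d).im := by simpa using hτ
    have hne : τ + d ≠ 0 := by intro h; rw [h] at him; simp at him
    have e1 : ((a : ℂ) * τ + b) / (((1 : ℕ) : ℂ) * τ + d) = -1 / (τ + d) + a := by
      rw [hb]; push_cast; field_simp; ring
    rw [e1, eta_add, eta_S _ him, eta_add]
    have : dedekindSum d 1 = 0 := by simp [dedekindSum]
    rw [this]
    push_cast
    have e2 : (Real.pi : ℂ) * Complex.I / 12 * (((a : ℂ) + d) / 1 - 12 * 0) =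
      (Real.pi : ℂ) * Complex.I / 12 * a + (Real.pi : ℂ) * Complex.I / 12 * d := by ring
    rw [e2, Complex.exp_add, one_mul]
    ring
  -- the case of lower right entry between 0 and c
  have key : ∀ (d : ℕ) (b : ℤ), 1 ≤ d → d < c → a * d - b * c = 1 → ∀ τ : ℂ, 0 < τ.im →
      dedekindEta (((a : ℂ) * τ + b) / ((c : ℂ) * τ + (d : ℤ))) =
      Complex.exp ((Real.pi : ℂ) * Complex.I / 12 *
          (((a : ℂ) + ((d : ℤ) : ℂ)) / (c : ℂ) - 12 * ((dedekindSum d c : ℝ) : ℂ))) *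
        (((c : ℂ) * τ + ((d : ℤ) : ℂ)) / Complex.I) ^ ((1 : ℂ) / 2) * dedekindEta τ := by
    intro d b hd1 hdc hdet τ hτ
    have hcop : Nat.Coprime c d := by
      rw [← Nat.isCoprime_iff_coprime]
      exact ⟨-b, a, by linarith⟩
    have hd0 : (d : ℂ) ≠ 0 := by
      have : d ≠ 0 := by omega
      exact_mod_cast this
    have hτ0 : τ ≠ 0 := by rintro rfl; simp at hτ
    have him : 0 < (-1 / τ).im := by
      have : 0 < normSq τ := normSq_pos.mpr hτ0
      rw [neg_div, one_div, neg_im, inv_im]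
      have := div_pos hτ this
      rw [neg_div, neg_neg]; exact this
    have himc : 0 < ((c : ℂ) * τ + (d : ℤ)).im := by
      have : (0 : ℝ) < c := by exact_mod_cast hc
      simpa using mul_pos this hτ
    have hne : (c : ℂ) * τ + (d : ℤ) ≠ 0 := by intro h; rw [h] at himc; simp at himc
    have himd : 0 < ((d : ℂ) * (-1 / τ) + ((-c : ℤ) : ℂ)).im := by
      have : (0 : ℝ) < d := by exact_mod_cast hd1
      have := mul_pos this him
      simpa using this
    have hI := ih d hdc hd1 b (-a) (-c) (by linarith) (-1 / τ) him
    have hned : (d : ℂ) * (-1 / τ) + ((-c : ℤ) : ℂ) ≠ 0 := by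
      intro h; rw [h] at himd; simp at himd
    have e1 : ((b : ℂ) * (-1 / τ) + ((-a : ℤ) : ℂ)) / ((d : ℂ) * (-1 / τ) + ((-c : ℤ) : ℂ)) =
        ((a : ℂ) * τ + b) / ((c : ℂ) * τ + (d : ℤ)) := by
      rw [div_eq_div_iff hned hne]
      push_cast
      field_simp
      ring
    rw [e1, eta_S τ hτ] at hI
    rw [hI, ds_neg c d hcop]
    have hsq : ((((d : ℂ) * (-1 / τ) + ((-c : ℤ) : ℂ)) / I) ^ ((1 : ℂ) / 2)) *
        (τ / I) ^ ((1 : ℂ) / 2) = Complex.exp (Real.pi * Complex.I / 12 * 3) *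
         (((c : ℂ) * τ + (d : ℤ)) / I) ^ ((1 : ℂ) / 2) := by
      rw [← cpow_div_I _ himc, cpow_mul_half]
      · congr 1
        push_cast
        field_simp
        rw [I_sq]
        ring
      · simpa [Complex.div_re] using himd
      · simpa [Complex.div_re] using hτ
    have hrec := congrArg (Complex.ofReal) (reciprocity d c hcop.symm hc hd1)
    have hdetC : (a : ℂ) * d - b * c = 1 := by exact_mod_cast hdet
    push_cast at hrec
    have hph : Complex.exp ((Real.pi : ℂ) * Complex.I / 12 *
          (((a : ℂ) + ((d : ℤ) : ℂ)) / (c : ℂ) - 12 * ((dedekindSum d c : ℝ) : ℂ))) =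
        Complex.exp ((Real.pi : ℂ) * Complex.I / 12 *
          (((b : ℂ) + ((-c : ℤ) : ℂ)) / (d : ℂ) - 12 * ((-dedekindSum c d : ℝ) : ℂ))) *
        Complex.exp (Real.pi * Complex.I / 12 * 3) := by
      rw [← Complex.exp_add]
      congr 1
      rw [← mul_add]
      congr 1
      push_cast
      have e3 : ((a : ℂ) + d) / c - (b + -c) / d = (d : ℂ) / c + (c : ℂ) / d + 1 / (d * c) := by
        field_simp
        linear_combination hdetC
      linear_combination e3 - hrec
    rw [hph]
    linear_combination (Complex.exp ((Real.pi : ℂ) * Complex.I / 12 *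
          (((b : ℂ) + ((-c : ℤ) : ℂ)) / (d : ℂ) - 12 * ((-dedekindSum c d : ℝ) : ℂ)))
           * dedekindEta τ) * hsq
  obtain ⟨d0, hd0⟩ : ∃ d0 : ℕ, (d0 : ℤ) = d % c :=
    ⟨(d % c).toNat, Int.toNat_of_nonneg (Int.emod_nonneg _ (by omega))⟩
  have hlt : d % (c : ℤ) < c := Int.emod_lt_of_pos _ (by omega)
  have hdecomp : d = d0 + (d / c) * c := by
    rw [hd0]; linarith [Int.emod_add_mul_ediv d c]
  generalize d / (c : ℤ) = n at hdecomp
  have hpos : 1 ≤ d0 := by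
    by_contra hcon
    have : d0 = 0 := by omega
    subst this
    have : (c : ℤ) * (a * n - b) = 1 := by
      rw [hdecomp] at hdet
      push_cast at hdet
      linarith
    have := Int.eq_one_of_mul_eq_one_right (by omega) this
    omega
  have hk := key d0 (b - n * a) hpos (by omega) (by rw [hdecomp] at hdet; linarith) (τ + n)
    (by simpa using hτ)
  rw [eta_add] at hk
  have e1 : (c : ℂ) * (τ + n) + ((d0 : ℤ) : ℂ) = c * τ + d := by
    rw [hdecomp]; push_cast; ring
  have e2 : (a : ℂ) * (τ + n) + ((b - n * a : ℤ) : ℂ) = a * τ + b := by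
    push_cast; ring
  rw [e1, e2] at hk
  rw [hk]
  have e3 : dedekindSum d c = dedekindSum d0 c := by rw [hdecomp, ds_add _ _ _ hc]
  have e4 : (Real.pi : ℂ) * Complex.I / 12 *
          (((a : ℂ) + (d : ℂ)) / (c : ℂ) - 12 * ((dedekindSum d c : ℝ) : ℂ)) =
      (Real.pi : ℂ) * Complex.I / 12 *
          (((a : ℂ) + ((d0 : ℤ) : ℂ)) / (c : ℂ) - 12 * ((dedekindSum d0 c : ℝ) : ℂ)) +
      (Real.pi : ℂ) * Complex.I / 12 * n := by
    rw [e3]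
    have : (d : ℂ) = d0 + n * c := by exact_mod_cast congrArg (Int.cast (R := ℂ)) hdecomp
    rw [this]
    push_cast
    field_simp
    ring
  rw [e4, Complex.exp_add]
  ring


/-- The transformation law of the Dedekind eta function: for `[a,b;c,d] ∈ SL₂(ℤ)`
with `c > 0` and `τ` in the upper half-plane,
`η((aτ+b)/(cτ+d)) = ε(a,b,c,d) √((cτ+d)/i) η(τ)` where
`ε(a,b,c,d) = exp(iπ/12 ((a+d)/c − 12 s(d,c)))`. -/
theorem eta_transformation (a b c d : ℤ) (hdet : a * d - b * c = 1) (hc : 0 < c)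
    (τ : ℂ) (hτ : 0 < τ.im) :
    dedekindEta (((a : ℂ) * τ + b) / ((c : ℂ) * τ + d)) =
      Complex.exp ((Real.pi : ℂ) * Complex.I / 12 *
          (((a : ℂ) + (d : ℂ)) / (c : ℂ) - 12 * ((dedekindSum d c.toNat : ℝ) : ℂ))) *
        (((c : ℂ) * τ + (d : ℂ)) / Complex.I) ^ ((1 : ℂ) / 2) * dedekindEta τ := by
  obtain ⟨n, rfl⟩ := Int.eq_ofNat_of_zero_le hc.le
  have := eta_main n (by omega) a b d hdet τ hτ
  simpa using this
end

section
/- For coprime positive integers h, k with ℓ ≥ 2, gcd(k,ℓ) = Q, Re(z) > 0, and h_Q an integer satisfying (ℓ/Q)·h·h_Q ≡ −1 (mod k/Q), the generating function f(q) = ∏_{n≥1}(1−q^n)^{−1} satisfies f(e^{2πiℓ(h/k + iz/k²)}) = √(ℓz/(kQ)) · e^{iπ s(ℓh/Q, k/Q) + (π/(12k))(Q²k/(ℓz) − ℓz/k)} · f(e^{2πiQ(h_Q/k + iQ/(ℓz))}). -/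
open Finset Complex

/-- The Euler partition generating function `f(q) = ∏_{n≥1} (1 − qⁿ)⁻¹`. -/
noncomputable def fEuler (q : ℂ) : ℂ := (∏' n : ℕ, (1 - q ^ (n + 1)))⁻¹

lemma aux_s1 (k : ℕ) (hk : 0 < k) : (∑ r ∈ Ico 1 k, (r : ℝ)) = (k : ℝ) * (k - 1) / 2 := by
  induction k, hk using Nat.le_induction with
  | base => simp
  | succ n hn ih => rw [sum_Ico_succ_top hn, ih]; push_cast; ring

lemma aux_s2 (k : ℕ) (hk : 0 < k) :
    (∑ r ∈ Ico 1 k, (r : ℝ) ^ 2) = (k : ℝ) * (k - 1) * (2 * k - 1) / 6 := by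
  induction k, hk using Nat.le_induction with
  | base => simp
  | succ n hn ih => rw [sum_Ico_succ_top hn, ih]; push_cast; ring

lemma aux_not_dvd {h k r : ℕ} (hc : Nat.Coprime h k) (hr : r ∈ Ico 1 k) : ¬ k ∣ h * r := by
  intro hd
  rw [Finset.mem_Ico] at hr
  have := Nat.le_of_dvd hr.1 (hc.symm.dvd_of_dvd_mul_left hd)
  omega

lemma aux_perm {h k : ℕ} (hc : Nat.Coprime h k) (F : ℕ → ℝ) :
    (∑ r ∈ Ico 1 k, F (h * r % k)) = ∑ r ∈ Ico 1 k, F r := by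
  have hmaps : Set.MapsTo (fun r => h * r % k) (Ico 1 k : Finset ℕ) (Ico 1 k : Finset ℕ) := by
    intro r hr
    have hr' := Finset.mem_coe.1 hr
    have h1 := aux_not_dvd hc hr'
    rw [Finset.mem_Ico] at hr'
    have hpos : 0 < k := by omega
    have h2 := Nat.mod_lt (h * r) hpos
    have h3 : h * r % k ≠ 0 := fun h0 => h1 (Nat.dvd_of_mod_eq_zero h0)
    refine Finset.mem_coe.2 (Finset.mem_Ico.2 ⟨?_, h2⟩)
    show 1 ≤ h * r % k
    omega
  have hinj : Set.InjOn (fun r => h * r % k) (Ico 1 k : Finset ℕ) := by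
    intro a ha b hb hab
    have ha' := Finset.mem_Ico.1 (Finset.mem_coe.1 ha)
    have hb' := Finset.mem_Ico.1 (Finset.mem_coe.1 hb)
    have h1 : h * a ≡ h * b [MOD k] := hab
    have h2 : a ≡ b [MOD k] := Nat.ModEq.cancel_left_of_coprime hc.symm h1
    exact Nat.ModEq.eq_of_lt_of_lt h2 ha'.2 hb'.2
  exact Finset.sum_nbij (fun r => h * r % k) (fun a ha => hmaps ha) hinj
    (Finset.surjOn_of_injOn_of_card_le _ hmaps hinj le_rfl) (fun _ _ => rfl)

lemma aux_tri (n : ℕ) : (∑ v ∈ Icc 1 n, (v : ℝ)) = (n : ℝ) * (n + 1) / 2 := by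
  have := aux_s1 (n + 1) (Nat.succ_pos n)
  rw [show Icc 1 n = Ico 1 (n + 1) from by ext; simp [Finset.mem_Ico], this]
  push_cast; ring

lemma aux_double {h k : ℕ} (hh : 0 < h) (hk : 0 < k) (hc : Nat.Coprime h k) :
    (∑ r ∈ Ico 1 k, ((h * r / k : ℕ) : ℝ) * ((h * r / k : ℕ) + 1) / 2)
      = ∑ v ∈ Ico 1 h, (v : ℝ) * ((k : ℝ) - 1 - (k * v / h : ℕ)) := by
  have h1 : ∀ r ∈ Ico 1 k, ((h * r / k : ℕ) : ℝ) * ((h * r / k : ℕ) + 1) / 2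
      = ∑ v ∈ Icc 1 (h * r / k), (v : ℝ) := fun r _ => (aux_tri _).symm
  rw [Finset.sum_congr rfl h1, Finset.sum_comm' (t' := Ico 1 h)
    (s' := fun v => Ico (k * v / h + 1) k)]
  · refine Finset.sum_congr rfl fun v hv => ?_
    rw [Finset.sum_const, Nat.card_Ico, nsmul_eq_mul]
    have hv' := Finset.mem_Ico.1 hv
    have : k * v / h + 1 ≤ k := by
      have : k * v / h < k := by
        rw [Nat.div_lt_iff_lt_mul hh]
        exact Nat.mul_lt_mul_of_pos_left hv'.2 hk
      omega
    rw [Nat.cast_sub this]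
    push_cast; ring
  · intro r v
    simp only [Finset.mem_Ico, Finset.mem_Icc]
    rw [Nat.le_div_iff_mul_le hk]
    constructor
    · rintro ⟨⟨h1, h2⟩, h3, h4⟩
      have hne : v * k ≠ h * r := fun he =>
        aux_not_dvd hc (Finset.mem_Ico.2 ⟨h1, h2⟩) ⟨v, by rw [← he, mul_comm]⟩
      have hlt : v * k < h * r := lt_of_le_of_ne h4 hne
      refine ⟨⟨?_, h2⟩, h3, ?_⟩
      · have : k * v / h < r := by
          rw [Nat.div_lt_iff_lt_mul hh]; nlinarith
        omega
      · by_contra hcon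
        have : h ≤ v := by omega
        nlinarith
    · rintro ⟨⟨h1, h2⟩, h3, h4⟩
      have : k * v / h < r := by omega
      rw [Nat.div_lt_iff_lt_mul hh] at this
      have hr1 : 1 ≤ r := by
        rcases Nat.eq_zero_or_pos r with h0 | h0
        · subst h0; simp at this
        · exact h0
      refine ⟨⟨hr1, h2⟩, h3, by nlinarith⟩

/-- `s(h,k)` through residues. -/
lemma aux_ded {h k : ℕ} (hk : 0 < k) :
    dedekindSum h k = (∑ r ∈ Ico 1 k, (r : ℝ) * (h * r % k : ℕ)) / k ^ 2 - ((k : ℝ) - 1) / 4 := by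
  have hk' : (k : ℝ) ≠ 0 := by positivity
  have h1 : ∀ r ∈ Ico 1 k, ((r : ℝ) / k) *
    ((((h : ℤ) * r : ℤ) : ℝ) / k - ⌊(((h : ℤ) * r : ℤ) : ℝ) / k⌋ - 1 / 2)
     = (r : ℝ) * (h * r % k : ℕ) / k ^ 2 - (r : ℝ) / (2 * k) := by
    intro r _
    have hf : ⌊(((h : ℤ) * r : ℤ) : ℝ) / k⌋ = ((h * r / k : ℕ) : ℤ) := by
      have := Nat.floor_div_eq_div (K := ℝ) (h * r) k
      rw [← this, Int.natCast_floor_eq_floor (by positivity)]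
      push_cast; rfl
    rw [hf, Int.cast_natCast]
    have hm : ((h * r : ℕ) : ℝ) = k * (h * r / k : ℕ) + (h * r % k : ℕ) := by
      exact_mod_cast (Nat.div_add_mod (h * r) k).symm
    rw [show (((h : ℤ) * r : ℤ) : ℝ) = ((h * r : ℕ) : ℝ) by push_cast; rfl, hm]
    field_simp
    ring
  unfold dedekindSum
  rw [Finset.sum_congr rfl h1, Finset.sum_sub_distrib, ← Finset.sum_div, ← Finset.sum_div,
    aux_s1 k hk]
  field_simp
  ring

/-- Dedekind reciprocity. -/
lemma ded_recip {h k : ℕ} (hh : 0 < h) (hk : 0 < k) (hc : Nat.Coprime h k) :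
    dedekindSum h k + dedekindSum k h
      = -1 / 4 + ((h : ℝ) / k + k / h + 1 / (h * k)) / 12 := by
  have hk' : (k : ℝ) ≠ 0 := by positivity
  have hh' : (h : ℝ) ≠ 0 := by positivity
  have hm : ∀ (a b r : ℕ), (a : ℝ) * r = b * (a * r / b : ℕ) + (a * r % b : ℕ) := by
    intro a b r
    exact_mod_cast (Nat.div_add_mod (a * r) b).symm
  rw [aux_ded hk, aux_ded hh]
  set X := ∑ r ∈ Ico 1 k, (r : ℝ) * (h * r % k : ℕ) with hX
  set Y := ∑ r ∈ Ico 1 h, (r : ℝ) * (k * r % h : ℕ) with hY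
  have e1 := aux_double hh hk hc
  have p1 : ∑ r ∈ Ico 1 k, ((h * r % k : ℕ) : ℝ) = _ := (aux_perm hc (fun x => (x : ℝ))).trans (aux_s1 k hk)
  have p2 : ∑ r ∈ Ico 1 k, ((h * r % k : ℕ) : ℝ) ^ 2 = _ :=
    (aux_perm hc (fun x => (x : ℝ) ^ 2)).trans (aux_s2 k hk)
  have l : (∑ r ∈ Ico 1 k, ((h * r / k : ℕ) : ℝ) * ((h * r / k : ℕ) + 1) / 2)
      = ((h : ℝ) ^ 2 * ∑ r ∈ Ico 1 k, (r : ℝ) ^ 2) / (2 * k ^ 2) - h * X / k ^ 2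
        + (∑ r ∈ Ico 1 k, ((h * r % k : ℕ) : ℝ) ^ 2) / (2 * k ^ 2)
        + (h * ∑ r ∈ Ico 1 k, (r : ℝ)) / (2 * k)
        - (∑ r ∈ Ico 1 k, ((h * r % k : ℕ) : ℝ)) / (2 * k) := by
    rw [hX]
    simp only [Finset.mul_sum, Finset.sum_div, ← Finset.sum_add_distrib, ← Finset.sum_sub_distrib]
    refine Finset.sum_congr rfl fun r _ => ?_
    have : ((h * r / k : ℕ) : ℝ) = (h * r - (h * r % k : ℕ)) / k := by
      rw [hm h k r]; field_simp; ring
    rw [this]; field_simp; ring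
  have r' : (∑ v ∈ Ico 1 h, (v : ℝ) * ((k : ℝ) - 1 - (k * v / h : ℕ)))
      = ((k : ℝ) - 1) * (∑ v ∈ Ico 1 h, (v : ℝ)) - (k * ∑ v ∈ Ico 1 h, (v : ℝ) ^ 2) / h
        + Y / h := by
    rw [hY]
    simp only [Finset.mul_sum, Finset.sum_div, ← Finset.sum_add_distrib, ← Finset.sum_sub_distrib]
    refine Finset.sum_congr rfl fun r _ => ?_
    have : ((k * r / h : ℕ) : ℝ) = (k * r - (k * r % h : ℕ)) / h := by
      rw [hm k h r]; field_simp; ring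
    rw [this]; field_simp; ring
  rw [l, r', p1, p2, aux_s1 k hk, aux_s2 k hk, aux_s1 h hh, aux_s2 h hh] at e1
  have : X / k ^ 2 + Y / h ^ 2 = (h * X / k ^ 2 + Y / h) / h := by field_simp
  have e2 : h * X / k ^ 2 + Y / h = (h : ℝ) ^ 2 * ((k : ℝ) * (k - 1) * (2 * k - 1) / 6) / (2 * k ^ 2)
     + ((k : ℝ) * (k - 1) * (2 * k - 1) / 6) / (2 * k ^ 2) + h * ((k : ℝ) * (k - 1) / 2) / (2 * k)
     - ((k : ℝ) * (k - 1) / 2) / (2 * k) - ((k : ℝ) - 1) * ((h : ℝ) * (h - 1) / 2)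
     + (k * ((h : ℝ) * (h - 1) * (2 * h - 1) / 6)) / h := by linear_combination -e1
  have e3 : X / k ^ 2 + Y / h ^ 2 = _ := this.trans (congrArg (· / (h : ℝ)) e2)
  rw [show X / (k : ℝ) ^ 2 - ((k : ℝ) - 1) / 4 + (Y / h ^ 2 - ((h : ℝ) - 1) / 4)
    = (X / k ^ 2 + Y / h ^ 2) - ((k : ℝ) - 1) / 4 - ((h : ℝ) - 1) / 4 by ring, e3]
  field_simp
  ring

lemma ded_neg {h k : ℕ} (hc : Nat.Coprime h k) :
    dedekindSum (-(h : ℤ)) k = - dedekindSum h k := by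
  unfold dedekindSum
  rw [← Finset.sum_neg_distrib]
  refine Finset.sum_congr rfl fun r hr => ?_
  have hk : (k : ℝ) ≠ 0 := by
    have := Finset.mem_Ico.1 hr
    have : 0 < k := by omega
    positivity
  have e : (((-(h : ℤ)) * r : ℤ) : ℝ) / k = - ((((h : ℤ) * r : ℤ) : ℝ) / k) := by push_cast; ring
  rw [e]
  have hne : Int.fract ((((h : ℤ) * r : ℤ) : ℝ) / k) ≠ 0 := by
    intro h0
    obtain ⟨m, hm⟩ := Int.fract_eq_zero_iff.1 h0
    apply aux_not_dvd hc hr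
    rw [eq_div_iff hk] at hm
    have : m * (k : ℤ) = (h : ℤ) * r := by exact_mod_cast hm
    exact Int.natCast_dvd_natCast.1 ⟨m, by push_cast; linarith⟩
  have h2 := Int.fract_neg hne
  rw [Int.fract, Int.fract] at h2
  rw [h2]; ring

lemma ded_mod (r m : ℤ) (k : ℕ) (hk : 0 < k) :
    dedekindSum (r + k * m) k = dedekindSum r k := by
  unfold dedekindSum
  refine Finset.sum_congr rfl fun j _ => ?_
  have hk' : (k : ℝ) ≠ 0 := by positivity
  have e : (((r + k * m) * j : ℤ) : ℝ) / k = ((r * j : ℤ) : ℝ) / k + ((m * j : ℤ) : ℝ) := by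
    push_cast; field_simp
  rw [e, Int.floor_add_intCast]
  push_cast; ring

lemma eta_S_s7 (t : ℂ) (ht : 0 < t.im) :
    ModularForm.eta (-1 / t) = cexp (Complex.log t / 2 - Real.pi * I / 4) * ModularForm.eta t := by
  have := ModularForm.eta_comp_eq_csqrt_I_inv (x := t) ht
  have ht0 : t ≠ 0 := by rintro rfl; simp at ht
  simp only [Function.comp_apply, Pi.smul_apply, Pi.mul_apply, smul_eq_mul] at this
  rw [this, sqrt_eq_exp ht0, sqrt_eq_exp I_ne_zero, ← Complex.exp_neg, ← mul_assoc,
    ← Complex.exp_add, Complex.log_I]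
  congr 2
  ring

lemma eta_T (t : ℂ) (n : ℤ) :
    ModularForm.eta (t + n) = cexp (Real.pi * I * n / 12) * ModularForm.eta t := by
  unfold ModularForm.eta
  have h1 : ∀ j, ModularForm.eta_q j (t + n) = ModularForm.eta_q j t := by
    intro j
    rw [ModularForm.eta_q_eq_pow, ModularForm.eta_q_eq_pow]
    congr 1
    rw [Complex.exp_eq_exp_iff_exists_int]
    exact ⟨n, by ring⟩
  simp only [h1, Function.Periodic.qParam]
  rw [← mul_assoc, ← Complex.exp_add]
  congr 2
  push_cast
  ring

lemma log_aux (z w t : ℂ) (hz : 0 < z.re) (hw : 0 < w.re) (ht : 0 < t.im) (h : w * t = z) :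
    Complex.log w + Complex.log t = Complex.log z := by
  have hz0 : z ≠ 0 := by rintro rfl; simp at hz
  have hw0 : w ≠ 0 := by rintro rfl; simp at hw
  have ht0 : t ≠ 0 := by rintro rfl; simp at ht
  have e : cexp (Complex.log w + Complex.log t) = cexp (Complex.log z) := by
    rw [Complex.exp_add, Complex.exp_log hw0, Complex.exp_log ht0, Complex.exp_log hz0, h]
  obtain ⟨n, hn⟩ := Complex.exp_eq_exp_iff_exists_int.1 e
  have him := congrArg Complex.im hn
  simp [Complex.log_im] at him
  have h1 := abs_lt.1 (Complex.abs_arg_lt_pi_div_two_iff.2 (Or.inl hz))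
  have h2 := abs_lt.1 (Complex.abs_arg_lt_pi_div_two_iff.2 (Or.inl hw))
  have h3 := Complex.arg_nonneg_iff.2 ht.le
  have h4 := Complex.arg_le_pi t
  have hp := Real.pi_pos
  have n1 : (n : ℝ) < 1 := by
    by_contra hc
    push Not at hc
    nlinarith
  have n2 : (-1 : ℝ) < n := by
    by_contra hc
    push Not at hc
    nlinarith
  have n1' : n < 1 := by exact_mod_cast n1
  have n2' : -1 < n := by exact_mod_cast n2
  have : n = 0 := by omega
  subst this
  simpa using hn

lemma re_inv_pos {z : ℂ} (hz : 0 < z.re) : 0 < (1 / z).re := by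
  have hz0 : z ≠ 0 := by rintro rfl; simp at hz
  rw [one_div, Complex.inv_re]
  exact div_pos hz (Complex.normSq_pos.2 hz0)

theorem eta_transf (K : ℕ) : ∀ (H H' : ℤ) (z : ℂ), 0 < K → (K : ℤ) ∣ H * H' + 1 → 0 < z.re →
    ModularForm.eta ((H' + I / z) / K) =
      cexp (Complex.log z / 2 + Real.pi * I * (dedekindSum H K + (H' - H) / (12 * K)))
        * ModularForm.eta ((H + I * z) / K) := by
  induction K using Nat.strong_induction_on with
  | _ K ih =>
  intro H H' z hK hd hz
  have hz0 : z ≠ 0 := by rintro rfl; simp at hz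
  have hKC : (K : ℂ) ≠ 0 := by exact_mod_cast hK.ne'
  by_cases hK1 : K = 1
  · subst hK1
    have hs : dedekindSum H 1 = 0 := by simp [dedekindSum]
    have him : 0 < (I * z).im := by simpa using hz
    have h1 := eta_S_s7 (I * z) him
    have e1 : (-1 : ℂ) / (I * z) = I / z := by
      rw [div_eq_div_iff (mul_ne_zero I_ne_zero hz0) hz0]
      linear_combination (-z) * I_mul_I
    have hl : Complex.log z + Complex.log I = Complex.log (I * z) := by
      have := log_aux z (z) I
      rw [Complex.log_mul I_ne_zero hz0 ?_, add_comm]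
      have h1 := abs_lt.1 (Complex.abs_arg_lt_pi_div_two_iff.2 (Or.inl hz))
      rw [Complex.arg_I]
      constructor <;> linarith [Real.pi_pos]
    have a1 := eta_T (I / z) H'
    have a2 := eta_T (I * z) H
    rw [hs]
    simp only [Nat.cast_one, div_one, mul_one]
    rw [add_comm (H' : ℂ), a1, add_comm (H : ℂ), a2, ← e1, h1, ← hl, Complex.log_I, ← mul_assoc,
      ← mul_assoc, ← Complex.exp_add, ← Complex.exp_add]
    congr 2
    push_cast
    ring
  -- reduce H modulo K
  have main : ∀ r : ℕ, 0 < r → r < K → (K : ℤ) ∣ r * H' + 1 →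
      ModularForm.eta ((H' + I / z) / K) =
      cexp (Complex.log z / 2 + Real.pi * I * (dedekindSum r K + (H' - r) / (12 * K)))
        * ModularForm.eta ((r + I * z) / K) := by
    intro r hr hrK ⟨K', hK'⟩
    have hrC : (r : ℂ) ≠ 0 := by exact_mod_cast hr.ne'
    have hc : Nat.Coprime r K := by
      rw [← Nat.isCoprime_iff_coprime]
      exact ⟨-H', K', by linear_combination -hK'⟩
    set t : ℂ := (r + I * z) / K with ht
    have htim : 0 < t.im := by
      rw [ht, Complex.div_natCast_im]
      have : 0 < (K : ℝ) := by exact_mod_cast hK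
      simpa using div_pos hz this
    have ht0 : t ≠ 0 := by intro h0; rw [h0] at htim; simp at htim
    have hnum : (r : ℂ) + I * z ≠ 0 := by
      intro h0; apply ht0; rw [ht, h0, zero_div]
    have hz2 : 0 < (z / t).re := by
      have e : z / t = 1 / (t / z) := by field_simp
      rw [e]
      apply re_inv_pos
      have e2 : t / z = (((r / K : ℝ) : ℝ) : ℂ) * (1 / z) + I / ((K : ℝ) : ℂ) := by
        rw [ht]; push_cast; field_simp
      rw [e2, Complex.add_re, Complex.re_ofReal_mul, Complex.div_ofReal_re]
      simp only [Complex.I_re, zero_div, add_zero]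
      exact mul_pos (by positivity) (re_inv_pos hz)
    have hKK : (r : ℂ) * H' + 1 = K * K' := by exact_mod_cast hK'
    have key := ih r hrK (-(K : ℤ)) K' (z / t) hr ⟨-H', by linear_combination hK'⟩ hz2
    have e1 : ((K' : ℂ) + I / (z / t)) / r = (H' + I / z) / K := by
      have : (K' : ℂ) = (r * H' + 1) / K := by rw [hKK]; field_simp
      rw [this, ht]
      field_simp
      linear_combination z * I_mul_I
    have e2 : (((-(K : ℤ) : ℤ) : ℂ) + I * (z / t)) / r = -1 / t := by
      rw [ht]
      push_cast
      field_simp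
      ring
    have hlog := log_aux z (z / t) t hz hz2 htim (by field_simp)
    have hrec := ded_recip hr hK hc
    have hrecC : (dedekindSum r K : ℂ) + dedekindSum K r
        = -1 / 4 + ((r : ℂ) / K + K / r + 1 / (r * K)) / 12 := by
      have := congrArg (fun x : ℝ => (x : ℂ)) hrec
      push_cast at this
      exact this
    rw [e1, e2, ded_neg hc.symm, eta_S_s7 t htim, ← mul_assoc, ← Complex.exp_add] at key
    rw [key]
    congr 2
    have e3 : ((K' : ℂ) - (-(K : ℤ) : ℤ)) / (12 * r)
      = (H' - r) / (12 * K) + ((r : ℂ) / K + K / r + 1 / (r * K)) / 12 := by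
      have : (K' : ℂ) = (r * H' + 1) / K := by rw [hKK]; field_simp
      rw [this]; push_cast; field_simp; ring
    rw [e3, ← hlog]
    push_cast
    linear_combination (Real.pi * I) * (-hrecC)
  have hKZ : (0 : ℤ) < K := by exact_mod_cast hK
  have hr0 := Int.emod_nonneg H hKZ.ne'
  have hr1 := Int.emod_lt_of_pos H hKZ
  obtain ⟨r, hr⟩ := Int.eq_ofNat_of_zero_le hr0
  have hH : H = r + K * (H / K) := by rw [← hr]; exact (Int.emod_add_mul_ediv H K).symm
  set m := H / K with hm
  have hdr : (K : ℤ) ∣ r * H' + 1 := by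
    have : (r : ℤ) * H' + 1 = (H * H' + 1) - K * (m * H') := by
      linear_combination (-H') * hH
    rw [this]
    exact dvd_sub hd (dvd_mul_right _ _)
  have hrpos : 0 < r := by
    rcases Nat.eq_zero_or_pos r with h0 | h0
    · subst h0
      have : (K : ℤ) ∣ 1 := by simpa using hdr
      have := Int.le_of_dvd one_pos this
      omega
    · exact h0
  have hm1 := main r hrpos (by omega) hdr
  have hHC : (H : ℂ) = r + K * m := by exact_mod_cast hH
  rw [hm1, show ((H : ℂ) + I * z) / K = (r + I * z) / K + m by rw [hHC]; field_simp; ring, eta_T,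
    ← mul_assoc, ← Complex.exp_add]
  rw [show dedekindSum H K = dedekindSum r K by rw [hH]; exact ded_mod r m K hK, hHC]
  congr 2
  field_simp
  ring

lemma fEuler_eq (t : ℂ) :
    fEuler (cexp (2 * Real.pi * I * t)) = cexp (Real.pi * I * t / 12) * (ModularForm.eta t)⁻¹ := by
  unfold fEuler ModularForm.eta
  simp only [ModularForm.eta_q_eq_pow, Function.Periodic.qParam]
  rw [mul_inv, ← mul_assoc, ← Complex.exp_neg, ← Complex.exp_add]
  rw [show (Real.pi * I * t / 12 + -(2 * Real.pi * I * t / ((24 : ℝ) : ℂ)) : ℂ) = 0 by push_cast; ring]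
  simp

/-- The transformation formula for `f(q^ℓ)` with `q = e^{2πi(h/k + iz/k²)}`:
for coprime positive `h, k`, `ℓ ≥ 2`, `Q = gcd(k,ℓ)`, `Re z > 0` and
`(ℓ/Q)·h·h_Q ≡ −1 (mod k/Q)`,
`f(e^{2πiℓ(h/k+iz/k²)}) = √(ℓz/(kQ)) e^{iπ s(ℓh/Q, k/Q) + (π/(12k))(Q²k/(ℓz) − ℓz/k)}
  f(e^{2πiQ(h_Q/k + iQ/(ℓz))})`. -/
theorem fEuler_pow_transformation (h k ℓ : ℕ) (hh : 0 < h) (hk : 0 < k) (hℓ : 2 ≤ ℓ)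
    (hcop : Nat.Coprime h k) (Q : ℕ) (hQ : Q = Nat.gcd k ℓ) (h_Q : ℤ)
    (hcong : ((ℓ / Q : ℕ) : ℤ) * (h : ℤ) * h_Q ≡ -1 [ZMOD ((k / Q : ℕ) : ℤ)])
    (z : ℂ) (hz : 0 < z.re) :
    fEuler (Complex.exp (2 * (Real.pi : ℂ) * Complex.I * (ℓ : ℂ) *
        ((h : ℂ) / k + Complex.I * z / (k : ℂ) ^ 2))) =
      ((ℓ : ℂ) * z / ((k : ℂ) * Q)) ^ ((1 : ℂ) / 2) *
        Complex.exp ((Real.pi : ℂ) * Complex.I *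
            ((dedekindSum ((ℓ / Q : ℕ) * (h : ℤ)) (k / Q) : ℝ) : ℂ) +
          (Real.pi : ℂ) / (12 * k) * ((Q : ℂ) ^ 2 * k / ((ℓ : ℂ) * z) - (ℓ : ℂ) * z / k)) *
        fEuler (Complex.exp (2 * (Real.pi : ℂ) * Complex.I * (Q : ℂ) *
          ((h_Q : ℂ) / k + Complex.I * Q / ((ℓ : ℂ) * z)))) := by
  have hQ0 : 0 < Q := by rw [hQ]; exact Nat.gcd_pos_of_pos_left _ hk
  obtain ⟨K, hkK⟩ : Q ∣ k := hQ ▸ Nat.gcd_dvd_left k ℓ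
  obtain ⟨L, hlL⟩ : Q ∣ ℓ := hQ ▸ Nat.gcd_dvd_right k ℓ
  have hKd : k / Q = K := by rw [hkK]; exact Nat.mul_div_cancel_left K hQ0
  have hLd : ℓ / Q = L := by rw [hlL]; exact Nat.mul_div_cancel_left L hQ0
  rw [hKd, hLd] at hcong
  rw [hKd, hLd]
  have hK0 : 0 < K := by
    rcases Nat.eq_zero_or_pos K with h0 | h0
    · subst h0; omega
    · exact h0
  have hL0 : 0 < L := by
    rcases Nat.eq_zero_or_pos L with h0 | h0
    · subst h0; omega
    · exact h0
  have hz0 : z ≠ 0 := by rintro rfl; simp at hz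
  have hKC : (K : ℂ) ≠ 0 := by exact_mod_cast hK0.ne'
  have hQC : (Q : ℂ) ≠ 0 := by exact_mod_cast hQ0.ne'
  have hLC : (L : ℂ) ≠ 0 := by exact_mod_cast hL0.ne'
  have hkC : (k : ℂ) = Q * K := by exact_mod_cast hkK
  have hlC : (ℓ : ℂ) = Q * L := by exact_mod_cast hlL
  set w : ℂ := (ℓ : ℂ) * z / ((k : ℂ) * Q) with hw
  have hw' : w = L * z / (K * Q) := by rw [hw, hkC, hlC]; field_simp
  have hwre : 0 < w.re := by
    have : w = ((L / (K * Q) : ℝ) : ℂ) * z := by rw [hw']; push_cast; ring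
    rw [this, Complex.re_ofReal_mul]
    exact mul_pos (by positivity) hz
  have hw0 : w ≠ 0 := by intro h0; rw [h0] at hwre; simp at hwre
  have hd : (K : ℤ) ∣ ((L : ℤ) * h) * h_Q + 1 := by
    have := (Int.modEq_iff_dvd.1 hcong.symm)
    simpa using this
  have key := eta_transf K ((L : ℤ) * h) h_Q w hK0 hd hwre
  have hne : ∀ x : ℂ, 0 < x.im → ModularForm.eta x ≠ 0 := fun x hx => ModularForm.eta_ne_zero hx
  have t1 : 2 * (Real.pi : ℂ) * Complex.I * (ℓ : ℂ) * ((h : ℂ) / k + Complex.I * z / (k : ℂ) ^ 2)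
      = 2 * Real.pi * I * (((((L : ℤ) * h : ℤ) : ℂ) + I * w) / K) := by
    rw [hw', hkC, hlC]; push_cast; field_simp
  have t2 : 2 * (Real.pi : ℂ) * Complex.I * (Q : ℂ) *
          ((h_Q : ℂ) / k + Complex.I * Q / ((ℓ : ℂ) * z))
      = 2 * Real.pi * I * (((h_Q : ℂ) + I / w) / K) := by
    rw [hw', hkC, hlC]; field_simp
  have i1 : ModularForm.eta (((((L : ℤ) * h : ℤ) : ℂ) + I * w) / K) ≠ 0 := by
    apply hne
    rw [Complex.div_natCast_im]
    have : 0 < (K : ℝ) := by exact_mod_cast hK0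
    simpa using div_pos hwre this
  rw [t1, t2, fEuler_eq, fEuler_eq, key, mul_inv, ← Complex.exp_neg,
    Complex.cpow_def_of_ne_zero hw0]
  simp only [← mul_assoc]
  congr 1
  simp only [← Complex.exp_add]
  congr 1
  have hzw : z = K * Q * w / L := by rw [hw']; field_simp
  rw [hzw, hkC, hlC]
  push_cast
  field_simp
  ring_nf
  try simp only [I_sq]
  try ring
end

section
/- As n → ∞, the r-colored ℓ-regular partition function satisfies b_ℓ^{(r)}(n) ~ (1/√2)·(1/ℓ)^{r/2}·((r/24)(1 − 1/ℓ))^{1/4}·n^{−3/4}·exp(4π√((nr/24)(1 − 1/ℓ))). -/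
open Finset Filter

/-- The number of `r`-colored `ℓ`-regular partitions of `n`. -/
noncomputable def coloredRegularCount (ℓ r n : ℕ) : ℕ :=
  Nat.card {f : Fin r → Σ m : ℕ, Nat.Partition m //
    (∀ i, ∀ x ∈ (f i).2.parts, ¬ ℓ ∣ x) ∧ (∑ i, (f i).1) = n}

open PowerSeries in
lemma crc_eq_coeff (ℓ r n : ℕ) : coloredRegularCount ℓ r n =
    coeff n ((PowerSeries.mk fun m => (Nat.Partition.restricted m (¬ ℓ ∣ ·)).card) ^ r) := by
  classical
  have h1 : ((PowerSeries.mk fun m => (Nat.Partition.restricted m (¬ ℓ ∣ ·)).card) ^ r : ℕ⟦X⟧)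
      = ∏ i ∈ (univ : Finset (Fin r)),
        (PowerSeries.mk fun m => (Nat.Partition.restricted m (¬ ℓ ∣ ·)).card) := by simp
  rw [h1, PowerSeries.coeff_prod]
  have e : {f : Fin r → Σ m : ℕ, Nat.Partition m //
      (∀ i, ∀ x ∈ (f i).2.parts, ¬ ℓ ∣ x) ∧ (∑ i, (f i).1) = n} ≃
      (Σ l : {l : Fin r →₀ ℕ // l ∈ finsuppAntidiag (univ : Finset (Fin r)) n},
        ∀ i : Fin r, {p : Nat.Partition (l.1 i) // p ∈ Nat.Partition.restricted (l.1 i) (¬ ℓ ∣ ·)}) :=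
    { toFun := fun f => ⟨⟨Finsupp.equivFunOnFinite.symm (fun i => (f.1 i).1), by
          simp [mem_finsuppAntidiag, f.2.2]⟩, fun i => ⟨(f.1 i).2, by
            exact Finset.mem_filter.mpr ⟨Finset.mem_univ _, f.2.1 i⟩⟩⟩
      invFun := fun g => ⟨fun i => ⟨g.1.1 i, (g.2 i).1⟩, by
        constructor
        · intro i
          exact (Finset.mem_filter.mp (g.2 i).2).2
        · have := g.1.2
          rw [mem_finsuppAntidiag] at this
          exact this.1⟩
      left_inv := fun f => rfl
      right_inv := by
        rintro ⟨⟨l, hl⟩, p⟩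
        obtain ⟨l', rfl⟩ := Finsupp.equivFunOnFinite.symm.surjective l
        rfl }
  unfold coloredRegularCount
  rw [Nat.card_congr e, Nat.card_sigma]
  simp only [Nat.card_pi, coeff_mk]
  refine Eq.trans ?_ (Finset.sum_coe_sort (finsuppAntidiag (univ : Finset (Fin r)) n)
    (fun l => ∏ i, (Nat.Partition.restricted (l i) (¬ ℓ ∣ ·)).card))
  refine Finset.sum_congr rfl fun l _ => Finset.prod_congr rfl fun i _ => ?_
  simp

/-- `F` evaluates (absolutely convergently) to `S` at `q`. -/
def PEval (F : PowerSeries ℕ) (q S : ℂ) : Prop :=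
  Summable (fun n => ‖((PowerSeries.coeff n F : ℕ) : ℂ) * q ^ n‖) ∧
    ∑' n, ((PowerSeries.coeff n F : ℕ) : ℂ) * q ^ n = S

lemma PEval.one (q : ℂ) : PEval 1 q 1 := by
  have : ∀ n ≠ 0, ((PowerSeries.coeff n (1 : PowerSeries ℕ) : ℕ) : ℂ) * q ^ n = 0 := by
    intro n hn; simp [PowerSeries.coeff_one, hn]
  constructor
  · apply summable_of_ne_finset_zero (s := {0})
    intro n hn
    rw [this n (by simpa using hn), norm_zero]
  · rw [tsum_eq_single 0 this]; simp

lemma PEval.mul {F G : PowerSeries ℕ} {q S T : ℂ} (hF : PEval F q S) (hG : PEval G q T) :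
    PEval (F * G) q (S * T) := by
  obtain ⟨a, ha⟩ : ∃ a : ℕ → ℂ, a = fun n => ((PowerSeries.coeff n F : ℕ) : ℂ) * q ^ n := ⟨_, rfl⟩
  obtain ⟨b, hb⟩ : ∃ b : ℕ → ℂ, b = fun n => ((PowerSeries.coeff n G : ℕ) : ℂ) * q ^ n := ⟨_, rfl⟩
  have h : (fun n => ((PowerSeries.coeff n (F * G) : ℕ) : ℂ) * q ^ n) =
      fun n => ∑ kl ∈ antidiagonal n, a kl.1 * b kl.2 := by
    funext n
    rw [PowerSeries.coeff_mul, Nat.cast_sum, Finset.sum_mul, ha, hb]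
    refine Finset.sum_congr rfl fun kl hkl => ?_
    rw [← mem_antidiagonal.mp hkl, pow_add, Nat.cast_mul]
    exact mul_mul_mul_comm _ _ _ _
  have hF1 : Summable fun n => ‖a n‖ := by rw [ha]; exact hF.1
  have hG1 : Summable fun n => ‖b n‖ := by rw [hb]; exact hG.1
  have hF2 : ∑' n, a n = S := by rw [ha]; exact hF.2
  have hG2 : ∑' n, b n = T := by rw [hb]; exact hG.2
  have e := congrFun h
  unfold PEval
  simp only [e]
  refine ⟨summable_norm_sum_mul_antidiagonal_of_summable_norm hF1 hG1, ?_⟩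
  rw [← tsum_mul_tsum_eq_tsum_sum_antidiagonal_of_summable_norm hF1 hG1, hF2, hG2]

lemma PEval.prod {ι : Type*} {F : ι → PowerSeries ℕ} {q : ℂ} {S : ι → ℂ} (s : Finset ι)
    (h : ∀ i, PEval (F i) q (S i)) : PEval (∏ i ∈ s, F i) q (∏ i ∈ s, S i) := by
  classical
  induction s using Finset.induction_on with
  | empty => simpa using PEval.one q
  | insert a s ha ih => rw [prod_insert ha, prod_insert ha]; exact (h a).mul ih

lemma PEval.pow {F : PowerSeries ℕ} {q S : ℂ} (h : PEval F q S) (r : ℕ) :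
    PEval (F ^ r) q (S ^ r) := by
  induction r with
  | zero => simpa using PEval.one q
  | succ k ih => rw [pow_succ, pow_succ]; exact ih.mul h

lemma PEval.sum_le {F : PowerSeries ℕ} {x : ℝ} (hx : 0 ≤ x) {S : ℂ} (h : PEval F (x : ℂ) S)
    (u : Finset ℕ) : ∑ n ∈ u, ((PowerSeries.coeff n F : ℕ) : ℝ) * x ^ n ≤ ‖S‖ := by
  have e : ∀ n, ‖((PowerSeries.coeff n F : ℕ) : ℂ) * (x : ℂ) ^ n‖ = ((PowerSeries.coeff n F : ℕ) : ℝ) * x ^ n := by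
    intro n; simp [abs_of_nonneg hx]
  have h1 := h.1
  simp_rw [e] at h1
  have h2 : S = ((∑' n, ((PowerSeries.coeff n F : ℕ) : ℝ) * x ^ n : ℝ) : ℂ) := by
    rw [← h.2]; push_cast; rfl
  rw [h2, Complex.norm_real]
  refine le_trans ?_ (le_abs_self _)
  exact h1.sum_le_tsum u (fun n _ => by positivity)

open PowerSeries PowerSeries.WithPiTopology in
lemma coeff_geom (k n : ℕ) (hk : 0 < k) :
    coeff n (∑' j : ℕ, (X : ℕ⟦X⟧) ^ (k * j)) = if k ∣ n then 1 else 0 := by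
  have hs : Summable (fun j : ℕ => (X : ℕ⟦X⟧) ^ (k * j)) := by
    simp_rw [pow_mul]
    exact summable_pow_of_constantCoeff_eq_zero (by simp [hk.ne'])
  have h := (hs.hasSum.map (coeff (R := ℕ) n) (continuous_coeff ℕ n)).tsum_eq
  rw [← h]
  simp only [Function.comp_def, coeff_X_pow]
  split_ifs with hd
  · obtain ⟨j, rfl⟩ := hd
    rw [tsum_eq_single j]
    · simp
    · intro b hb
      rw [if_neg]
      intro h
      exact hb (Nat.eq_of_mul_eq_mul_left hk h).symm
  · convert tsum_zero with b
    rw [if_neg]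
    rintro rfl
    exact hd (dvd_mul_right _ _)

open PowerSeries PowerSeries.WithPiTopology in
lemma PEval.geom {q : ℂ} (hq : ‖q‖ < 1) (k : ℕ) (hk : 0 < k) :
    PEval (∑' j : ℕ, (X : ℕ⟦X⟧) ^ (k * j)) q (1 - q ^ k)⁻¹ := by
  have hinj : Function.Injective (fun j : ℕ => k * j) := fun a b h => Nat.eq_of_mul_eq_mul_left hk h
  have hz : ∀ n ∉ Set.range (fun j : ℕ => k * j),
      ((coeff n (∑' j : ℕ, (X : ℕ⟦X⟧) ^ (k * j)) : ℕ) : ℂ) * q ^ n = 0 := by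
    intro n hn
    rw [coeff_geom k n hk, if_neg]
    · simp
    · rintro ⟨j, rfl⟩; exact hn ⟨j, rfl⟩
  have hq' : ‖q ^ k‖ < 1 := by
    rw [norm_pow]; exact pow_lt_one₀ (norm_nonneg _) hq hk.ne'
  have hc : (fun n => ((coeff n (∑' j : ℕ, (X : ℕ⟦X⟧) ^ (k * j)) : ℕ) : ℂ) * q ^ n) ∘ 
      (fun j : ℕ => k * j) = fun j => (q ^ k) ^ j := by
    ext j
    simp only [Function.comp_def]
    rw [coeff_geom k _ hk]
    simp [pow_mul]
  constructor
  · have := (hinj.summable_iff (f := fun n => ‖((coeff n (∑' j : ℕ, (X : ℕ⟦X⟧) ^ (k * j)) : ℕ) : ℂ) * q ^ n‖)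
      (fun n hn => by rw [hz n hn, norm_zero])).mp
    apply this
    have h2 : (fun n => ‖((coeff n (∑' j : ℕ, (X : ℕ⟦X⟧) ^ (k * j)) : ℕ) : ℂ) * q ^ n‖) ∘ 
      (fun j : ℕ => k * j) = fun j => ‖q ^ k‖ ^ j := by
      ext j
      have := congrFun hc j
      simp only [Function.comp_def] at this ⊢
      rw [this, norm_pow]
    rw [h2]
    exact summable_geometric_of_lt_one (norm_nonneg _) hq'
  · have := (hinj.hasSum_iff hz (a := (1 - q ^ k)⁻¹)).mp (by
      rw [hc]; exact hasSum_geometric_of_norm_lt_one hq')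
    exact this.tsum_eq

/-- product of `1 - q^m` over `m` not divisible by `ℓ`. -/
noncomputable def Ereg (ℓ : ℕ) (q : ℂ) : ℂ := ∏' i : ℕ, if ℓ ∣ i + 1 then 1 else 1 - q ^ (i + 1)

lemma multipliable_Ereg (ℓ : ℕ) {q : ℂ} (hq : ‖q‖ < 1) :
    Multipliable fun i : ℕ => if ℓ ∣ i + 1 then 1 else 1 - q ^ (i + 1) := by
  have h := multipliable_one_add_of_summable (f := fun i : ℕ => if ℓ ∣ i + 1 then 0 else -q ^ (i + 1)) (by
    refine Summable.of_nonneg_of_le (fun _ => norm_nonneg _) (fun i => ?_)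
      ((summable_nat_add_iff 1).mpr (summable_geometric_of_lt_one (norm_nonneg _) hq))
    split_ifs <;> simp)
  refine h.congr fun i => ?_
  split_ifs <;> simp [sub_eq_add_neg]

lemma one_sub_pow_ne {q : ℂ} (hq : ‖q‖ < 1) (i : ℕ) : 1 - q ^ (i + 1) ≠ 0 := by
  intro h
  have : ‖q ^ (i + 1)‖ < 1 := by
    rw [norm_pow]; exact pow_lt_one₀ (norm_nonneg _) hq (by simp)
  rw [← sub_eq_zero.mp h] at this
  simp at this

lemma Ereg_ne_zero (ℓ : ℕ) {q : ℂ} (hq : ‖q‖ < 1) : Ereg ℓ q ≠ 0 := by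
  have h := tprod_one_add_ne_zero_of_summable (f := fun i : ℕ => if ℓ ∣ i + 1 then 0 else -q ^ (i + 1)) 
    (by intro i; have := one_sub_pow_ne hq i; split_ifs <;> simp [← sub_eq_add_neg, this])
    (by
    refine Summable.of_nonneg_of_le (fun _ => norm_nonneg _) (fun i => ?_)
      ((summable_nat_add_iff 1).mpr (summable_geometric_of_lt_one (norm_nonneg _) hq))
    split_ifs <;> simp)
  convert h using 1
  unfold Ereg
  refine tprod_congr fun i => ?_
  split_ifs <;> simp [sub_eq_add_neg]

lemma tendsto_Ereg_inv (ℓ : ℕ) {q : ℂ} (hq : ‖q‖ < 1) :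
    Tendsto (fun s : Finset ℕ => ∏ i ∈ s, if ¬ ℓ ∣ i + 1 then (1 - q ^ (i + 1))⁻¹ else 1) atTop
      (nhds (Ereg ℓ q)⁻¹) := by
  have h := (multipliable_Ereg ℓ hq).hasProd
  have h2 : Tendsto _ atTop _ := Tendsto.inv₀ (h : Tendsto _ _ _) (Ereg_ne_zero ℓ hq)
  refine h2.congr fun s => ?_
  simp only [← Finset.prod_inv_distrib]
  refine Finset.prod_congr rfl fun i _ => ?_
  split_ifs <;> simp

open PowerSeries PowerSeries.WithPiTopology in
lemma PEval_regular (ℓ : ℕ) {q : ℂ} (hq : ‖q‖ < 1) :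
    PEval (PowerSeries.mk fun m => (Nat.Partition.restricted m (¬ ℓ ∣ ·)).card) q (Ereg ℓ q)⁻¹ := by
  set c : ℕ → ℕ := fun m => (Nat.Partition.restricted m (¬ ℓ ∣ ·)).card with hc
  have H := Nat.Partition.hasProd_powerSeriesMk_card_restricted ℕ (¬ ℓ ∣ ·)
  set g : ℕ → ℕ⟦X⟧ := fun i => if ¬ ℓ ∣ (i + 1) then ∑' j : ℕ, X ^ ((i + 1) * j) else 1 with hg
  have hge : ∀ (q : ℂ), ‖q‖ < 1 → ∀ i, PEval (g i) q (if ¬ ℓ ∣ i + 1 then (1 - q ^ (i + 1))⁻¹ else 1) := by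
    intro q hq i
    simp only [hg]
    split_ifs
    · exact PEval.one q
    · exact PEval.geom hq (i + 1) (by simp)
  have hev : ∀ n, ∀ᶠ s : Finset ℕ in atTop, coeff n (∏ i ∈ s, g i) = c n := by
    intro n
    have h1 : Tendsto (fun s : Finset ℕ => ∏ i ∈ s, g i) atTop (nhds (PowerSeries.mk c)) := by
      simpa [HasProd, hc] using H
    have h2 := ((continuous_coeff ℕ n).tendsto _).comp h1
    rw [coeff_mk] at h2
    have h3 := h2.eventually (isOpen_discrete ({c n} : Set ℕ) |>.mem_nhds rfl)
    exact h3
  have h0 : ∀ i, coeff 0 (g i) = 1 := by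
    intro i
    simp only [hg]
    split_ifs
    · simp
    · rw [coeff_geom _ _ (by simp)]; simp
  have hle : ∀ n s, coeff n (∏ i ∈ s, g i) ≤ c n := by
    intro n s
    obtain ⟨s', hs', h'⟩ := ((hev n).and (eventually_ge_atTop s)).exists
    rw [← hs', ← Finset.prod_sdiff h', mul_comm, coeff_mul]
    have h1 : coeff 0 (∏ i ∈ s' \ s, g i) = 1 := by
      rw [coeff_zero_eq_constantCoeff_apply, map_prod]
      refine Finset.prod_eq_one fun i _ => ?_
      rw [← coeff_zero_eq_constantCoeff_apply, h0]
    have := Finset.single_le_sum (f := fun p : ℕ × ℕ => coeff p.1 (∏ i ∈ s, g i) * coeff p.2 (∏ i ∈ s' \ s, g i)) (s := antidiagonal n)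
      (fun _ _ => Nat.zero_le _) (a := (n, 0)) (by simp)
    simpa [h1] using this
  have hsum : ∀ x : ℝ, 0 ≤ x → x < 1 → Summable (fun n => (c n : ℝ) * x ^ n) := by
    intro x hx hx1
    have hxn : ‖(x : ℂ)‖ < 1 := by simpa [abs_of_nonneg hx] using hx1
    apply summable_of_sum_le (c := ‖(Ereg ℓ x)⁻¹‖) (fun n => by positivity)
    intro u
    refine ge_of_tendsto (tendsto_Ereg_inv ℓ hxn).norm ?_
    have : ∀ᶠ s : Finset ℕ in atTop, ∀ n ∈ u, coeff n (∏ i ∈ s, g i) = c n :=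
      (Filter.eventually_all_finset u).mpr (fun n _ => hev n)
    filter_upwards [this] with s hs
    refine le_trans (le_of_eq ?_) ((PEval.prod s (hge x hxn)).sum_le hx u)
    exact Finset.sum_congr rfl fun n hn => by rw [hs n hn]
  have hS := hsum ‖q‖ (norm_nonneg _) hq
  refine ⟨by simpa [hc] using hS, ?_⟩
  refine tendsto_nhds_unique ?_ (tendsto_Ereg_inv ℓ hq)
  have key := tendsto_tsum_of_dominated_convergence (𝓕 := (atTop : Filter (Finset ℕ)))
    (f := fun s n => ((coeff n (∏ i ∈ s, g i) : ℕ) : ℂ) * q ^ n)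
    (g := fun n => ((coeff n (PowerSeries.mk c) : ℕ) : ℂ) * q ^ n) hS ?_ ?_
  · refine key.congr fun s => (PEval.prod s (hge q hq)).2
  · intro n
    apply tendsto_const_nhds.congr'
    filter_upwards [hev n] with s hs
    rw [hs, coeff_mk]
  · refine Eventually.of_forall fun s n => ?_
    rw [norm_mul, norm_pow, Complex.norm_natCast]
    gcongr
    exact_mod_cast hle n s

lemma PEval_colored (ℓ r : ℕ) {q : ℂ} (hq : ‖q‖ < 1) :
    Summable (fun n => ‖(coloredRegularCount ℓ r n : ℂ) * q ^ n‖) ∧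
    ∑' n, (coloredRegularCount ℓ r n : ℂ) * q ^ n = (Ereg ℓ q)⁻¹ ^ r := by
  simpa [PEval, ← crc_eq_coeff] using (PEval_regular ℓ hq).pow r

/-- Euler product. -/
noncomputable def Eul (q : ℂ) : ℂ := ∏' i : ℕ, (1 - q ^ (i + 1))

lemma Eul_ne_zero {q : ℂ} (hq : ‖q‖ < 1) : Eul q ≠ 0 := by
  have h := tprod_one_add_ne_zero_of_summable (f := fun i : ℕ => -q ^ (i + 1)) 
    (by intro i; have := one_sub_pow_ne hq i; simp [← sub_eq_add_neg, this])
    (by simpa using 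
      ((summable_nat_add_iff 1).mpr (summable_geometric_of_lt_one (norm_nonneg _) hq)))
  simpa [Eul, sub_eq_add_neg] using h

lemma Eul_split (ℓ : ℕ) (hℓ : 0 < ℓ) {q : ℂ} (hq : ‖q‖ < 1) :
    Ereg ℓ q * Eul (q ^ ℓ) = Eul q := by
  have h1 : Multipliable fun i : ℕ => if ℓ ∣ i + 1 then 1 - q ^ (i + 1) else 1 := by
    have h := multipliable_one_add_of_summable (f := fun i : ℕ => if ℓ ∣ i + 1 then -q ^ (i + 1) else 0) (by
      refine Summable.of_nonneg_of_le (fun _ => norm_nonneg _) (fun i => ?_)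
        ((summable_nat_add_iff 1).mpr (summable_geometric_of_lt_one (norm_nonneg _) hq))
      split_ifs <;> simp)
    refine h.congr fun i => ?_
    split_ifs <;> simp [sub_eq_add_neg]
  have h2 : Eul (q ^ ℓ) = ∏' i : ℕ, if ℓ ∣ i + 1 then 1 - q ^ (i + 1) else 1 := by
    unfold Eul
    symm
    refine tprod_eq_tprod_of_ne_one_bij (fun i ↦ (i.val + 1) * ℓ - 1) ?_ ?_ ?_
    · intro a b h
      simp only at h
      rw [tsub_left_inj (by nlinarith) (by nlinarith), mul_left_inj' (hℓ.ne.symm), add_left_inj] at h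
      exact SetCoe.ext h
    · intro i hi
      have hd : ℓ ∣ i + 1 := by
        by_contra hd
        simp [hd] at hi
      obtain ⟨j, hj⟩ := hd
      have hj0 : j ≠ 0 := by rintro rfl; simp at hj
      obtain ⟨k, rfl⟩ := Nat.exists_eq_succ_of_ne_zero hj0
      refine ⟨⟨k, ?_⟩, ?_⟩
      · have := one_sub_pow_ne (q := q ^ ℓ) (by rw [norm_pow]; exact pow_lt_one₀ (norm_nonneg _) hq hℓ.ne') k
        rw [Function.mem_mulSupport] at hi ⊢
        rw [← pow_mul, Nat.add_one, ← hj]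
        simpa [hj] using hi
      · simp only
        rw [mul_comm, Nat.add_one, ← hj]; simp
    · intro i
      have : (i.val + 1) * ℓ - 1 + 1 = (i.val + 1) * ℓ := Nat.sub_add_cancel (by nlinarith)
      simp only [this, ← pow_mul]
      rw [if_pos (dvd_mul_left _ _), mul_comm]
  rw [h2, Ereg, ← (multipliable_Ereg ℓ hq).tprod_mul h1, Eul]
  refine tprod_congr fun i => ?_
  split_ifs <;> simp

open ModularForm in
lemma eta_eq_Eul (τ : ℂ) : eta τ = Complex.exp (2 * Real.pi * Complex.I * τ / 24) *
    Eul (Complex.exp (2 * Real.pi * Complex.I * τ)) := by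
  simp [eta, Eul, eta_q, Function.Periodic.qParam]

lemma norm_exp_neg_lt {z : ℂ} (hz : 0 < z.re) : ‖Complex.exp (-z)‖ < 1 := by
  rw [Complex.norm_exp]; simpa using hz

lemma Eul_transform {z : ℂ} (hz : 0 < z.re) :
    Eul (Complex.exp (-z)) = Complex.exp (z / 24) *
      (Complex.sqrt Complex.I / Complex.sqrt (Complex.I * z / (2 * Real.pi))) *
      Complex.exp (-(Real.pi ^ 2 / 6) / z) * Eul (Complex.exp (-(4 * Real.pi ^ 2 / z))) := by
  have hz0 : z ≠ 0 := by rintro rfl; simp at hz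
  have hpi : (Real.pi : ℂ) ≠ 0 := by exact_mod_cast Real.pi_ne_zero
  set τ : ℂ := Complex.I * z / (2 * Real.pi) with hτ
  have hτ0 : τ ≠ 0 := by
    simp only [hτ]; exact div_ne_zero (mul_ne_zero Complex.I_ne_zero hz0) (by simpa using hpi)
  have hmem : τ ∈ UpperHalfPlane.upperHalfPlaneSet := by
    have : τ = ((2 * Real.pi)⁻¹ : ℝ) * (Complex.I * z) := by
      rw [hτ]; push_cast; field_simp
    show 0 < τ.im
    rw [this, Complex.im_ofReal_mul]
    have : 0 < Real.pi := Real.pi_pos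
    simp; positivity
  have h := ModularForm.eta_comp_eq_csqrt_I_inv hmem
  simp only [Function.comp_def, Pi.smul_apply, Pi.mul_apply, smul_eq_mul] at h
  rw [eta_eq_Eul, eta_eq_Eul] at h
  have e1 : 2 * Real.pi * Complex.I * τ = -z := by
    rw [hτ]; field_simp; simp
  have e2 : 2 * Real.pi * Complex.I * (-1 / τ) = -(4 * Real.pi ^ 2 / z) := by
    rw [hτ]; field_simp; ring
  rw [e1, e2] at h
  have s1 : Complex.sqrt Complex.I ≠ 0 := by simp [Complex.sqrt]
  have s2 : Complex.sqrt τ ≠ 0 := by simp [Complex.sqrt, hτ0]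
  have e3 : -(4 * Real.pi ^ 2 / z) / 24 = -(Real.pi ^ 2 / 6) / z := by ring
  rw [e3] at h
  have e4 : Complex.exp (z / 24) * Complex.exp (-(z / 24)) = 1 := by
    rw [← Complex.exp_add]; ring_nf; simp
  calc Eul (Complex.exp (-z)) = Complex.exp (z / 24) * (Complex.sqrt Complex.I / Complex.sqrt τ) *
        ((Complex.sqrt Complex.I)⁻¹ * (Complex.sqrt τ * (Complex.exp (-z / 24) * Eul (Complex.exp (-z))))) := by
        field_simp
        linear_combination (-Eul (Complex.exp (-z))) * e4
    _ = _ := by rw [← h]; ring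

lemma RCLike_sqrt_eq_exp_aux {z : ℂ} (hz : z ≠ 0) :
    Complex.sqrt z = Complex.exp (Complex.log z / 2) := by
  simp [Complex.sqrt, Complex.cpow_def, hz, div_eq_mul_inv]

lemma csqrt_natCast_mul (ℓ : ℕ) (hℓ : 0 < ℓ) {x : ℂ} (hx : x ≠ 0) :
    Complex.sqrt (ℓ * x) = (Real.sqrt ℓ : ℝ) * Complex.sqrt x := by
  have hl : (0 : ℝ) < ℓ := by exact_mod_cast hℓ
  have hl' : (ℓ : ℂ) ≠ 0 := by exact_mod_cast hℓ.ne'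
  rw [RCLike_sqrt_eq_exp_aux (mul_ne_zero hl' hx), RCLike_sqrt_eq_exp_aux hx]
  have h := Complex.log_ofReal_mul hl hx
  push_cast at h
  rw [h, add_div, Complex.exp_add]
  congr 1
  rw [Real.sqrt_eq_rpow, Real.rpow_def_of_pos hl]
  push_cast
  ring_nf

lemma Ereg_inv_eq (ℓ : ℕ) (hℓ : 0 < ℓ) {z : ℂ} (hz : 0 < z.re) :
    (Ereg ℓ (Complex.exp (-z)))⁻¹ = ((Real.sqrt ℓ : ℝ) : ℂ)⁻¹ *
      Complex.exp ((Real.pi ^ 2 / 6) * (1 - 1 / ℓ) / z) *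
      (Complex.exp ((ℓ - 1) * z / 24) *
      (Eul (Complex.exp (-(4 * Real.pi ^ 2 / (ℓ * z)))) / Eul (Complex.exp (-(4 * Real.pi ^ 2 / z))))) := by
  have hz0 : z ≠ 0 := by rintro rfl; simp at hz
  have hl : (0 : ℝ) < ℓ := by exact_mod_cast hℓ
  have hl' : (ℓ : ℂ) ≠ 0 := by exact_mod_cast hℓ.ne'
  have hpi : (Real.pi : ℂ) ≠ 0 := by exact_mod_cast Real.pi_ne_zero
  have hlz : 0 < (ℓ * z : ℂ).re := by
    rw [← Complex.ofReal_natCast, Complex.re_ofReal_mul]; positivity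
  have hs := Eul_split ℓ hℓ (norm_exp_neg_lt hz)
  have hq : Complex.exp (-z) ^ ℓ = Complex.exp (-(ℓ * z)) := by
    rw [← Complex.exp_nat_mul]; ring_nf
  rw [hq] at hs
  have n1 := Eul_ne_zero (norm_exp_neg_lt hz)
  have n2 := Eul_ne_zero (norm_exp_neg_lt hlz)
  have n3 := Ereg_ne_zero ℓ (norm_exp_neg_lt hz)
  have h1 : (Ereg ℓ (Complex.exp (-z)))⁻¹ = Eul (Complex.exp (-(ℓ * z))) / Eul (Complex.exp (-z)) := by
    rw [← hs, div_mul_cancel_right₀ n2]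
  have hτ0 : Complex.I * z / (2 * Real.pi) ≠ 0 := 
    div_ne_zero (mul_ne_zero Complex.I_ne_zero hz0) (by simp [hpi])
  have e1 : Complex.I * (ℓ * z) / (2 * Real.pi) = ℓ * (Complex.I * z / (2 * Real.pi)) := by ring
  rw [h1, Eul_transform hz, Eul_transform hlz, e1, csqrt_natCast_mul ℓ hℓ hτ0]
  have s1 : Complex.sqrt Complex.I ≠ 0 := by simp [Complex.sqrt]
  have s2 : Complex.sqrt (Complex.I * z / (2 * Real.pi)) ≠ 0 := by simp only [Complex.sqrt]; simp [hz0, hpi]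
  have s3 : ((Real.sqrt ℓ : ℝ) : ℂ) ≠ 0 := by
    exact_mod_cast (Real.sqrt_pos.mpr hl).ne'
  have x1 : Complex.exp (ℓ * z / 24) = Complex.exp ((ℓ - 1) * z / 24) * Complex.exp (z / 24) := by
    rw [← Complex.exp_add]; ring_nf
  have x2 : Complex.exp (-(Real.pi ^ 2 / 6) / (ℓ * z)) = 
     Complex.exp ((Real.pi ^ 2 / 6) * (1 - 1 / ℓ) / z) * Complex.exp (-(Real.pi ^ 2 / 6) / z) := by
    rw [← Complex.exp_add]; congr 1; field_simp; ring
  rw [x1, x2]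
  generalize Complex.sqrt (Complex.I * z / (2 * Real.pi)) = σ at s2 ⊢
  have n4 := Complex.exp_ne_zero (z / 24)
  have n5 := Complex.exp_ne_zero (-(Real.pi ^ 2 / 6) / z)
  generalize Complex.exp (z / 24) = a1 at n4 ⊢
  generalize Complex.exp (-(Real.pi ^ 2 / 6) / z) = a2 at n5 ⊢
  generalize Eul _ = b1
  generalize Eul _ = b2
  generalize Complex.exp _ = b3
  generalize Complex.exp _ = b4
  generalize Complex.sqrt _ = b5 at s1 ⊢
  generalize ((Real.sqrt ℓ : ℝ) : ℂ) = b6 at s3 ⊢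
  field_simp

/-- the cone. -/
def cone : Set ℂ := {z | 0 < z.re ∧ |z.im| ≤ z.re}

lemma tendsto_Eul_zero : Tendsto Eul (nhds 0) (nhds 1) := by
  have := tendsto_tprod_one_add_of_dominated_convergence (𝓕 := nhds 0) (g := 0)
    (f := fun (q : ℂ) (n : ℕ) ↦ -q ^ (n + 1)) (bound := fun n ↦ (1 / 2 : ℝ) ^ (n + 1))
  simp only [Pi.zero_apply, norm_neg, norm_pow, add_zero, tprod_one] at this
  unfold Eul
  simp_rw [sub_eq_add_neg]
  refine this
    (by simpa only [pow_succ'] using (summable_geometric_of_abs_lt_one (by norm_num)).mul_left _)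
    (fun k ↦ by simpa using ((continuous_pow (M := ℂ) (k + 1)).tendsto 0).neg) ?_
  filter_upwards [Metric.ball_mem_nhds (0 : ℂ) (by norm_num : (0 : ℝ) < 1 / 2)] with q hq k
  exact pow_le_pow_left₀ (norm_nonneg _) (mem_ball_zero_iff.mp hq).le _

lemma tendsto_exp_cone (a : ℝ) (ha : 0 < a) :
    Tendsto (fun z : ℂ => Complex.exp (-(a / z))) (nhdsWithin 0 cone) (nhds 0) := by
  rw [tendsto_zero_iff_norm_tendsto_zero]
  simp_rw [Complex.norm_exp]
  apply Real.tendsto_exp_atBot.comp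
  have h1 : Tendsto (fun z : ℂ => z.re) (nhdsWithin 0 cone) (nhdsWithin 0 (Set.Ioi 0)) := by
    apply tendsto_nhdsWithin_iff.mpr
    constructor
    · have := Complex.continuous_re.tendsto 0
      exact (this.mono_left nhdsWithin_le_nhds)
    · filter_upwards [self_mem_nhdsWithin] with z hz using hz.1
  have h2 : Tendsto (fun z : ℂ => (a / 2) * (z.re)⁻¹) (nhdsWithin 0 cone) atTop :=
    (tendsto_inv_nhdsGT_zero.comp h1).const_mul_atTop (by positivity)
  refine tendsto_atBot_mono' _ ?_ (tendsto_neg_atTop_atBot.comp h2)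
  filter_upwards [self_mem_nhdsWithin] with z hz
  have e : (-((a : ℂ) / z)).re = -(a * (z.re / Complex.normSq z)) := by
    rw [Complex.neg_re, div_eq_mul_inv, Complex.re_ofReal_mul, Complex.inv_re]
  rw [e]
  simp only [Function.comp_def, neg_le_neg_iff]
  have hz1 := hz.1
  have : Complex.normSq z ≤ 2 * z.re ^ 2 := by
    rw [Complex.normSq_apply]
    nlinarith [hz.2, abs_nonneg z.im, sq_abs z.im]
  have hp : 0 < Complex.normSq z := by
    rw [Complex.normSq_apply]; nlinarith [mul_pos hz1 hz1, mul_self_nonneg z.im]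
  have : (2 * z.re)⁻¹ ≤ z.re / Complex.normSq z := by
    rw [inv_eq_one_div, div_le_div_iff₀ (by positivity) hp]; nlinarith
  calc a / 2 * z.re⁻¹ = a * (2 * z.re)⁻¹ := by field_simp
    _ ≤ _ := by gcongr

/-- normalised generating function -/
noncomputable def Rf (ℓ r : ℕ) (z : ℂ) : ℂ := (Ereg ℓ (Complex.exp (-z)))⁻¹ ^ r *
  Complex.exp (-((r * (Real.pi ^ 2 / 6) * (1 - 1 / ℓ) : ℝ) / z))

lemma tendsto_Rf (ℓ r : ℕ) (hℓ : 0 < ℓ) :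
    Tendsto (Rf ℓ r) (nhdsWithin 0 cone) (nhds (((Real.sqrt ℓ)⁻¹ ^ r : ℝ) : ℂ)) := by
  have hl : (0 : ℝ) < ℓ := by exact_mod_cast hℓ
  have hl' : (ℓ : ℂ) ≠ 0 := by exact_mod_cast hℓ.ne'
  have hpi := Real.pi_pos
  have t1 := tendsto_Eul_zero.comp (tendsto_exp_cone (4 * Real.pi ^ 2 / ℓ) (by positivity))
  have t2 := tendsto_Eul_zero.comp (tendsto_exp_cone (4 * Real.pi ^ 2) (by positivity))
  have t3 : Tendsto (fun z : ℂ => Complex.exp ((ℓ - 1) * z / 24)) (nhdsWithin 0 cone) (nhds 1) := by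
    have : Continuous (fun z : ℂ => Complex.exp ((ℓ - 1) * z / 24)) := by fun_prop
    have := this.tendsto 0
    simp only [mul_zero, zero_div, Complex.exp_zero] at this
    exact this.mono_left nhdsWithin_le_nhds
  have t4 := ((tendsto_const_nhds (x := ((Real.sqrt ℓ : ℝ) : ℂ)⁻¹)).mul (t3.mul (t1.div t2 one_ne_zero))).pow r
  have e : ((((Real.sqrt ℓ)⁻¹ ^ r : ℝ)) : ℂ) = (((Real.sqrt ℓ : ℝ) : ℂ)⁻¹ * (1 * (1 / 1))) ^ r := by
    push_cast; simp
  rw [e]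
  refine t4.congr' ?_
  filter_upwards [self_mem_nhdsWithin] with z hz
  have hz0 : z ≠ 0 := by rintro rfl; simpa using hz.1
  have e5 : (4 * Real.pi ^ 2 / ℓ : ℂ) / z = 4 * Real.pi ^ 2 / (ℓ * z) := by field_simp
  have e6 : Complex.exp ((Real.pi ^ 2 / 6) * (1 - 1 / ℓ) / z) ^ r *
    Complex.exp (-((r * (Real.pi ^ 2 / 6) * (1 - 1 / ℓ) : ℝ) / z)) = 1 := by
    rw [← Complex.exp_nat_mul, ← Complex.exp_add]
    push_cast
    ring_nf
    simp
  simp only [Function.comp_def, Rf, Pi.div_apply]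
  push_cast at e6 ⊢
  rw [Ereg_inv_eq ℓ hℓ hz.1, e5]
  simp only [mul_pow]
  linear_combination (-(((Real.sqrt ℓ : ℝ) : ℂ)⁻¹ ^ r * (Complex.exp ((ℓ - 1) * z / 24) ^ r *
      (Eul (Complex.exp (-(4 * Real.pi ^ 2 / (ℓ * z)))) / Eul (Complex.exp (-(4 * Real.pi ^ 2 / z)))) ^ r))) * e6

lemma factor_bound {w : ℂ} (hw : ‖w‖ < 1) :
    (1 - ‖w‖) * Real.exp (‖w‖ - w.re) ≤ ‖1 - w‖ := by
  have h1 := Complex.hasSum_re (Complex.hasSum_taylorSeries_neg_log hw)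
  have h2 := Complex.hasSum_re (Complex.hasSum_taylorSeries_neg_log (z := ((‖w‖ : ℝ) : ℂ)) (by simpa using hw))
  have h3 := h2.sub h1
  have hpos : 0 < 1 - ‖w‖ := by linarith
  have hne : 1 - w ≠ 0 := by
    intro h
    rw [← sub_eq_zero.mp h] at hw
    simp at hw
  have hterm : ∀ n : ℕ, (((‖w‖ : ℝ) : ℂ) ^ n / n).re - (w ^ n / n).re = (‖w‖ ^ n - (w ^ n).re) / n := by
    intro n
    rw [← Complex.ofReal_pow, Complex.div_natCast_re, Complex.div_natCast_re, Complex.ofReal_re]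
    ring
  have h4 := le_hasSum h3 1 (fun n _ => by
    rw [hterm]
    have : (w ^ n).re ≤ ‖w‖ ^ n := by
      rw [← norm_pow]; exact Complex.re_le_norm _
    exact div_nonneg (by linarith) (by positivity))
  rw [hterm] at h4
  simp only [pow_one, Nat.cast_one, div_one, Complex.neg_re, Complex.log_re] at h4
  have e : ‖(1 : ℂ) - ((‖w‖ : ℝ) : ℂ)‖ = 1 - ‖w‖ := by
    rw [← Complex.ofReal_one, ← Complex.ofReal_sub, Complex.norm_real, Real.norm_of_nonneg hpos.le]
  rw [e] at h4
  calc (1 - ‖w‖) * Real.exp (‖w‖ - w.re) ≤ (1 - ‖w‖) * Real.exp (Real.log ‖1 - w‖ - Real.log (1 - ‖w‖)) := by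
        exact mul_le_mul_of_nonneg_left (Real.exp_le_exp.mpr (by linarith)) hpos.le
    _ = ‖1 - w‖ := by
        rw [Real.exp_sub, Real.exp_log (norm_pos_iff.mpr hne), Real.exp_log hpos]; field_simp

/-- deficiency terms -/
noncomputable def dterm (ℓ : ℕ) (q : ℂ) (i : ℕ) : ℝ :=
  if ℓ ∣ i + 1 then 0 else ‖q‖ ^ (i + 1) - (q ^ (i + 1)).re

lemma dterm_nonneg (ℓ : ℕ) (q : ℂ) (i : ℕ) : 0 ≤ dterm ℓ q i := by
  unfold dterm
  split_ifs
  · rfl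
  · rw [← norm_pow]; linarith [Complex.re_le_norm (q ^ (i + 1))]

lemma dterm_summable (ℓ : ℕ) {q : ℂ} (hq : ‖q‖ < 1) : Summable (dterm ℓ q) := by
  have h1 := ((summable_nat_add_iff 1).mpr (summable_geometric_of_lt_one (norm_nonneg _) hq)).mul_left 2
  refine Summable.of_nonneg_of_le (dterm_nonneg ℓ q) (fun i => ?_) h1
  unfold dterm
  split_ifs
  · positivity
  · have := Complex.abs_re_le_norm (q ^ (i + 1))
    rw [norm_pow] at this
    linarith [neg_abs_le (q ^ (i + 1)).re]

lemma Ereg_norm_bound (ℓ : ℕ) {q : ℂ} (hq : ‖q‖ < 1) :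
    ‖Ereg ℓ ((‖q‖ : ℝ) : ℂ)‖ * Real.exp (∑' i, dterm ℓ q i) ≤ ‖Ereg ℓ q‖ := by
  have hq' : ‖((‖q‖ : ℝ) : ℂ)‖ < 1 := by simpa using hq
  have t1 : Tendsto _ atTop _ := (multipliable_Ereg ℓ hq').hasProd
  have t2 : Tendsto _ atTop _ := (multipliable_Ereg ℓ hq).hasProd
  have t3 : Tendsto _ atTop _ := (dterm_summable ℓ hq).hasSum
  refine le_of_tendsto_of_tendsto' (t1.norm.mul ((Real.continuous_exp.tendsto _).comp t3)) t2.norm ?_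
  intro s
  simp only [Function.comp_def]
  rw [norm_prod, norm_prod, Real.exp_sum, ← Finset.prod_mul_distrib]
  refine Finset.prod_le_prod (fun i _ => by positivity) fun i _ => ?_
  unfold dterm
  split_ifs
  · simp
  · have h := factor_bound (w := q ^ (i + 1)) (by
      rw [norm_pow]; exact pow_lt_one₀ (norm_nonneg _) hq (by simp))
    have e : ‖(1 : ℂ) - ((‖q‖ : ℝ) : ℂ) ^ (i + 1)‖ = 1 - ‖q‖ ^ (i + 1) := by
      rw [← Complex.ofReal_pow, ← Complex.ofReal_one, ← Complex.ofReal_sub, Complex.norm_real, 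
        Real.norm_of_nonneg]
      have := pow_le_one₀ (norm_nonneg q) hq.le (n := i + 1)
      linarith
    rw [e]
    rw [norm_pow] at h
    exact h

lemma dterm_seq (ℓ a : ℕ) (ha : a + 1 < ℓ) {q : ℂ} (hq : ‖q‖ < 1) (v : ℕ → ℝ) (V : ℝ)
    (hv : ∀ j, v j ≤ ‖q‖ ^ (ℓ * j + a + 1) - (q ^ (ℓ * j + a + 1)).re) (hV : HasSum v V) :
    V ≤ ∑' i, dterm ℓ q i := by
  refine hasSum_le_inj (fun j : ℕ => ℓ * j + a) ?_ ?_ ?_ hV (dterm_summable ℓ hq).hasSum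
  · intro i j h
    exact Nat.eq_of_mul_eq_mul_left (by omega : 0 < ℓ) (by simpa using h)
  · exact fun c _ => dterm_nonneg ℓ q c
  · intro j
    have : ¬ ℓ ∣ ℓ * j + a + 1 := by
      rw [add_assoc, Nat.dvd_add_right (dvd_mul_right _ _)]
      intro h
      have := Nat.le_of_dvd (by simp) h
      omega
    simp only [dterm, this, if_false]
    exact hv j

lemma hasSum_seq (ℓ a : ℕ) (hℓ : 0 < ℓ) {q : ℂ} (hq : ‖q‖ < 1) :
    HasSum (fun j => q ^ (ℓ * j + a + 1)) (q ^ (a + 1) / (1 - q ^ ℓ)) := by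
  have hq' : ‖q ^ ℓ‖ < 1 := by
    rw [norm_pow]; exact pow_lt_one₀ (norm_nonneg _) hq hℓ.ne'
  have e : (fun j => q ^ (ℓ * j + a + 1)) = fun j => q ^ (a + 1) * (q ^ ℓ) ^ j := by
    funext j; rw [← pow_mul, ← pow_add]; congr 1; ring
  rw [e, div_eq_mul_inv]
  exact (hasSum_geometric_of_norm_lt_one hq').mul_left (q ^ (a + 1))

lemma hasSum_seq_real (ℓ a : ℕ) (hℓ : 0 < ℓ) {x : ℝ} (hx0 : 0 ≤ x) (hx : x < 1) :
    HasSum (fun j => x ^ (ℓ * j + a + 1)) (x ^ (a + 1) / (1 - x ^ ℓ)) := by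
  have hq' : x ^ ℓ < 1 := pow_lt_one₀ hx0 hx hℓ.ne'
  have e : (fun j => x ^ (ℓ * j + a + 1)) = fun j => x ^ (a + 1) * (x ^ ℓ) ^ j := by
    funext j; rw [← pow_mul, ← pow_add]; congr 1; ring
  rw [e, div_eq_mul_inv]
  exact (hasSum_geometric_of_lt_one (by positivity) hq').mul_left (x ^ (a + 1))

lemma D_ge_one (ℓ : ℕ) (hℓ : 2 ≤ ℓ) {q : ℂ} (hq : ‖q‖ < 1) :
    ‖q‖ / (1 - ‖q‖ ^ ℓ) - (q / (1 - q ^ ℓ)).re ≤ ∑' i, dterm ℓ q i := by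
  have h1 := (hasSum_seq_real ℓ 0 (by omega) (norm_nonneg q) hq).sub
    (Complex.hasSum_re (hasSum_seq ℓ 0 (by omega) hq))
  simp only [zero_add, pow_one] at h1
  exact dterm_seq ℓ 0 (by omega) hq _ _ (fun j => le_rfl) h1

lemma cos_ineq (a b : ℝ) : 1 - Real.cos (b - a) ≤ 2 * (1 - Real.cos a) + 2 * (1 - Real.cos b) := by
  rw [Real.cos_sub]
  nlinarith [sq_nonneg (Real.cos a + Real.cos b - 2), sq_nonneg (Real.sin a + Real.sin b),
    Real.sin_sq_add_cos_sq a, Real.sin_sq_add_cos_sq b]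

lemma one_sub_cos_ge {x : ℝ} (hx : |x| ≤ Real.pi) : 2 / Real.pi ^ 2 * x ^ 2 ≤ 1 - Real.cos x := by
  linarith [Real.cos_le_one_sub_mul_cos_sq hx]

lemma qpow (t θ : ℝ) (m : ℕ) : (Complex.exp (-(t + θ * Complex.I))) ^ m =
    Complex.exp (((-(m * t) : ℝ) : ℂ) + ((-(m * θ) : ℝ) : ℂ) * Complex.I) := by
  rw [← Complex.exp_nat_mul]; congr 1; push_cast; ring

lemma qpow_re (t θ : ℝ) (m : ℕ) : ((Complex.exp (-(t + θ * Complex.I))) ^ m).re =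
    Real.exp (-t) ^ m * Real.cos (m * θ) := by
  rw [qpow, Complex.exp_re]; simp [← Real.exp_nat_mul]

lemma qnorm (t θ : ℝ) : ‖Complex.exp (-(t + θ * Complex.I))‖ = Real.exp (-t) := by
  rw [Complex.norm_exp]; simp

lemma D_ge_two (ℓ : ℕ) (hℓ : 3 ≤ ℓ) {t : ℝ} (ht : 0 < t) (θ : ℝ) :
    (1 - Real.cos θ) / 4 * (Real.exp (-t) ^ 2 / (1 - Real.exp (-t) ^ ℓ)) ≤
      ∑' i, dterm ℓ (Complex.exp (-(t + θ * Complex.I))) i := by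
  set q := Complex.exp (-(t + θ * Complex.I)) with hqdef
  have hqn : ‖q‖ = Real.exp (-t) := qnorm t θ
  have hx : Real.exp (-t) < 1 := by simpa using ht
  have hq : ‖q‖ < 1 := by rw [hqn]; exact hx
  have key : ∀ a, a + 1 < ℓ → HasSum (fun j => Real.exp (-t) ^ (ℓ * j + a + 1) - (q ^ (ℓ * j + a + 1)).re)
     (Real.exp (-t) ^ (a + 1) / (1 - Real.exp (-t) ^ ℓ) - (q ^ (a + 1) / (1 - q ^ ℓ)).re) := fun a ha =>
    (hasSum_seq_real ℓ a (by omega) (Real.exp_pos _).le hx).sub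
    (Complex.hasSum_re (hasSum_seq ℓ a (by omega) hq))
  have k0 := key 0 (by omega)
  have k1 := key 1 (by omega)
  have b0 := dterm_seq ℓ 0 (by omega) hq _ _ (fun j => by rw [hqn]) k0
  have b1 := dterm_seq ℓ 1 (by omega) hq _ _ (fun j => by rw [hqn]) k1
  have hs := (hasSum_seq_real ℓ 1 (by omega) (Real.exp_pos (-t)).le hx).mul_left ((1 - Real.cos θ) / 2)
  have := hasSum_le (fun j => ?_) hs (k0.add k1)
  · norm_num at this b0 b1 ⊢
    linarith
  · rw [hqdef, qpow_re, qpow_re]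
    set x := Real.exp (-t) with hxd
    have hxp : 0 < x := Real.exp_pos _
    have c := cos_ineq (((ℓ * j + 0 + 1 : ℕ) : ℝ) * θ) (((ℓ * j + 1 + 1 : ℕ) : ℝ) * θ)
    have e : ((ℓ * j + 1 + 1 : ℕ) : ℝ) * θ - ((ℓ * j + 0 + 1 : ℕ) : ℝ) * θ = θ := by push_cast; ring
    rw [e] at c
    have hm : x ^ (ℓ * j + 1 + 1) ≤ x ^ (ℓ * j + 0 + 1) := 
      pow_le_pow_of_le_one hxp.le hx.le (by omega)
    have c1 := Real.cos_le_one (((ℓ * j + 0 + 1 : ℕ) : ℝ) * θ)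
    have p : 0 < x ^ (ℓ * j + 1 + 1) := by positivity
    generalize Real.cos (((ℓ * j + 0 + 1 : ℕ) : ℝ) * θ) = u at *
    generalize Real.cos (((ℓ * j + 1 + 1 : ℕ) : ℝ) * θ) = v at *
    generalize x ^ (ℓ * j + 1 + 1) = X at *
    generalize x ^ (ℓ * j + 0 + 1) = Y at *
    nlinarith [mul_le_mul_of_nonneg_left c p.le, mul_nonneg (sub_nonneg.mpr hm) (sub_nonneg.mpr c1)]

lemma pi_sq_lt_ten : Real.pi ^ 2 < 10 := by
  have := Real.pi_lt_d2
  nlinarith [Real.pi_pos]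

lemma norm_one_sub_q_sq (t θ : ℝ) (m : ℕ) :
    ‖1 - (Complex.exp (-(t + θ * Complex.I))) ^ m‖ ^ 2 =
      (1 - Real.exp (-t) ^ m) ^ 2 + 2 * Real.exp (-t) ^ m * (1 - Real.cos (m * θ)) := by
  have h2 : ‖(Complex.exp (-(t + θ * Complex.I))) ^ m‖ ^ 2 = (Real.exp (-t) ^ m) ^ 2 := by
    rw [norm_pow, qnorm]
  have h1 := qpow_re t θ m
  rw [← Complex.normSq_eq_norm_sq, Complex.normSq_apply] at h2 ⊢
  simp only [Complex.sub_re, Complex.one_re, Complex.sub_im, Complex.one_im]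
  rw [h1] at h2 ⊢
  nlinarith

set_option maxHeartbeats 1000000 in
lemma minor_D (ℓ : ℕ) (hℓ : 2 ≤ ℓ) {t θ : ℝ} (ht : 0 < t) (ht2 : t ≤ 1 / (2 * ℓ))
    (h1 : t ≤ |θ|) (h2 : |θ| ≤ Real.pi) :
    1 / (24 * (ℓ : ℝ) ^ 3) / t ≤ ∑' i, dterm ℓ (Complex.exp (-(t + θ * Complex.I))) i := by
  have hl : (2 : ℝ) ≤ ℓ := by exact_mod_cast hℓ
  have hlp : (0 : ℝ) < ℓ := by linarith
  have hlt : ℓ * t ≤ 1 / 2 := by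
    calc ℓ * t ≤ ℓ * (1 / (2 * ℓ)) := by gcongr
      _ = 1 / 2 := by field_simp
  have hltp : 0 < ℓ * t := by positivity
  have hqn := qnorm t θ
  have hx : Real.exp (-t) < 1 := by simpa using ht
  have hyl : 1 - ℓ * t ≤ Real.exp (-t) ^ ℓ := by
    rw [← Real.exp_nat_mul]
    have := Real.add_one_le_exp (ℓ * -t)
    linarith
  have hxl : 1 / 2 ≤ Real.exp (-t) := by
    have := Real.add_one_le_exp (-t)
    nlinarith
  have hy1 : Real.exp (-t) ^ ℓ < 1 := pow_lt_one₀ (Real.exp_pos _).le hx (by omega)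
  set q := Complex.exp (-(t + θ * Complex.I)) with hqd
  set x := Real.exp (-t) with hxd
  have hq : ‖q‖ < 1 := by rw [hqn]; exact hx
  have hxp : 0 < x := by linarith
  have hpi := Real.pi_pos
  have hpi2 := pi_sq_lt_ten
  rcases le_or_gt |θ| (Real.pi / ℓ) with h3 | h3
  · -- region one
    have D := D_ge_one ℓ hℓ hq
    rw [hqn] at D
    have hc := one_sub_cos_ge (x := ℓ * θ) (by
      rw [abs_mul, abs_of_pos hlp, mul_comm]
      exact (le_div_iff₀ hlp).mp h3)
    have hn := norm_one_sub_q_sq t θ ℓ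
    rw [← hqd, ← hxd] at hn
    set y := x ^ ℓ with hy
    have hsq : (1 - y) ^ 2 ≤ (ℓ * θ) ^ 2 := by
      rw [mul_pow, ← sq_abs θ, ← mul_pow]
      apply pow_le_pow_left₀ (by linarith)
      nlinarith
    have h25 : 1 / 5 ≤ 2 / Real.pi ^ 2 := by
      rw [div_le_div_iff₀ (by norm_num) (by positivity)]; linarith
    have hc2 : 1 / 5 * (1 - y) ^ 2 ≤ 1 - Real.cos (ℓ * θ) := by
      refine le_trans ?_ hc
      exact mul_le_mul h25 hsq (by positivity) (by positivity)
    have hn2 : (12 / 11 * (1 - y)) ^ 2 ≤ ‖1 - q ^ ℓ‖ ^ 2 := by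
      rw [hn]
      have : 1 ≤ 2 * y := by linarith
      nlinarith [sq_nonneg (1 - y), mul_le_mul_of_nonneg_right this (le_trans (by positivity) hc2)]
    have hn3 : 12 / 11 * (1 - y) ≤ ‖1 - q ^ ℓ‖ := 
      le_of_sq_le_sq hn2 (norm_nonneg _)
    have hr : (q / (1 - q ^ ℓ)).re ≤ x / (12 / 11 * (1 - y)) := by
      refine (Complex.re_le_norm _).trans ?_
      rw [norm_div, hqn]
      have : 0 < 12 / 11 * (1 - y) := by linarith
      gcongr
    have hy0 : 0 < 1 - y := by linarith
    have e : x / (1 - y) - x / (12 / 11 * (1 - y)) = (1 / 12) * (x / (1 - y)) := by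
      field_simp; norm_num
    have f : 1 / (2 * (ℓ * t)) ≤ x / (1 - y) := by
      rw [div_le_div_iff₀ (by positivity) hy0]
      nlinarith
    have g : 1 / (24 * (ℓ : ℝ) ^ 3) / t ≤ 1 / 12 * (1 / (2 * (ℓ * t))) := by
      rw [div_div, ← mul_div_mul_comm, one_mul]
      apply one_div_le_one_div_of_le (by positivity)
      have : (1 : ℝ) ≤ ℓ ^ 2 := by nlinarith
      nlinarith
    linarith
  · have hcos : 2 / (ℓ : ℝ) ^ 2 ≤ 1 - Real.cos θ := by
      refine le_trans ?_ (one_sub_cos_ge h2)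
      have : (Real.pi / ℓ) ^ 2 ≤ θ ^ 2 := by
        rw [← sq_abs θ]; exact pow_le_pow_left₀ (by positivity) h3.le 2
      calc 2 / (ℓ : ℝ) ^ 2 = 2 / Real.pi ^ 2 * (Real.pi / ℓ) ^ 2 := by field_simp
        _ ≤ _ := by gcongr
    have hy0 : 0 < 1 - x ^ ℓ := by linarith
    rcases Nat.lt_or_ge 2 ℓ with h4 | h4
    · have D := D_ge_two ℓ h4 ht θ
      rw [← hqd, ← hxd] at D
      refine le_trans ?_ D
      have f : 1 / (4 * (ℓ * t)) ≤ x ^ 2 / (1 - x ^ ℓ) := by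
        rw [div_le_div_iff₀ (by positivity) hy0]
        have h5 : 1 / 4 ≤ x ^ 2 := by
          have := pow_le_pow_left₀ (by norm_num) hxl 2
          norm_num at this ⊢
          exact this
        have h6 := mul_le_mul_of_nonneg_right h5 hltp.le
        linarith
      calc 1 / (24 * (ℓ : ℝ) ^ 3) / t ≤ (2 / (ℓ : ℝ) ^ 2) / 4 * (1 / (4 * (ℓ * t))) := by
            have : (2 / (ℓ : ℝ) ^ 2) / 4 * (1 / (4 * (ℓ * t))) = 3 * (1 / (24 * (ℓ : ℝ) ^ 3) / t) := by
              field_simp; norm_num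
            rw [this]
            have : 0 ≤ 1 / (24 * (ℓ : ℝ) ^ 3) / t := by positivity
            linarith
        _ ≤ _ := by
            gcongr
            linarith [Real.cos_le_one θ]
    · obtain rfl : ℓ = 2 := by omega
      have D := D_ge_one 2 hℓ hq
      rw [hqn] at D
      have hcn : Real.cos θ ≤ 0 := by
        rw [← Real.cos_abs]
        apply Real.cos_nonpos_of_pi_div_two_le_of_le
        · exact_mod_cast h3.le
        · linarith
      have hre : (q / (1 - q ^ 2)).re ≤ 0 := by
        have hqr : q.re ≤ 0 := by
          have := qpow_re t θ 1
          simp only [pow_one, Nat.cast_one, one_mul] at this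
          rw [hqd, this]
          exact mul_nonpos_of_nonneg_of_nonpos hxp.le hcn
        have hns : q.re ^ 2 + q.im ^ 2 < 1 := by
          have : ‖q‖ ^ 2 < 1 := pow_lt_one₀ (norm_nonneg _) hq (by norm_num)
          rw [← Complex.normSq_eq_norm_sq, Complex.normSq_apply] at this
          nlinarith
        rw [Complex.div_re, ← add_div]
        apply div_nonpos_of_nonpos_of_nonneg _ (Complex.normSq_nonneg _)
        have e : q.re * (1 - q ^ 2).re + q.im * (1 - q ^ 2).im = q.re * (1 - (q.re ^ 2 + q.im ^ 2)) := by
          simp [pow_two]; ring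
        rw [e]
        exact mul_nonpos_of_nonpos_of_nonneg hqr (by linarith)
      have f : 1 / (4 * t) ≤ x / (1 - x ^ 2) := by
        rw [div_le_div_iff₀ (by positivity) hy0]
        norm_num at hyl
        nlinarith
      have g : 1 / (24 * ((2 : ℕ) : ℝ) ^ 3) / t ≤ 1 / (4 * t) := by
        rw [div_div]
        apply one_div_le_one_div_of_le (by positivity)
        push_cast; linarith
      linarith

lemma minor_bound (ℓ r : ℕ) (hℓ : 2 ≤ ℓ) (hr : 1 ≤ r) {t θ : ℝ} (ht : 0 < t) (ht2 : t ≤ 1 / (2 * ℓ))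
    (h1 : t ≤ |θ|) (h2 : |θ| ≤ Real.pi) :
    ‖(Ereg ℓ (Complex.exp (-(t + θ * Complex.I))))⁻¹ ^ r‖ ≤
     ‖(Ereg ℓ (Complex.exp (-(t : ℂ))))⁻¹ ^ r‖ * Real.exp (-(1 / (24 * (ℓ : ℝ) ^ 3) / t)) := by
  have hqn := qnorm t θ
  have hx : Real.exp (-t) < 1 := by simpa using ht
  have hq : ‖Complex.exp (-(t + θ * Complex.I))‖ < 1 := by rw [hqn]; exact hx
  have hb := Ereg_norm_bound ℓ hq
  have hD := minor_D ℓ hℓ ht ht2 h1 h2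
  rw [hqn] at hb
  have e : ((Real.exp (-t) : ℝ) : ℂ) = Complex.exp (-(t : ℂ)) := by push_cast; rfl
  rw [e] at hb
  have hp0 : 0 < ‖Ereg ℓ (Complex.exp (-(t : ℂ)))‖ := norm_pos_iff.mpr (Ereg_ne_zero ℓ (by
    rw [← e, Complex.norm_real, Real.norm_of_nonneg (Real.exp_pos _).le]; exact hx))
  have hp1 : 0 < ‖Ereg ℓ (Complex.exp (-(t + θ * Complex.I)))‖ := norm_pos_iff.mpr (Ereg_ne_zero ℓ hq)
  set c := 1 / (24 * (ℓ : ℝ) ^ 3) / t with hc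
  have hc0 : 0 ≤ c := by positivity
  have h3 : ‖Ereg ℓ (Complex.exp (-(t + θ * Complex.I)))‖⁻¹ ≤ 
      ‖Ereg ℓ (Complex.exp (-(t : ℂ)))‖⁻¹ * Real.exp (-c) := by
    rw [Real.exp_neg, ← mul_inv]
    apply inv_anti₀ (by positivity)
    refine le_trans ?_ hb
    gcongr
  rw [norm_pow, norm_pow, norm_inv, norm_inv]
  calc _ ≤ (‖Ereg ℓ (Complex.exp (-(t : ℂ)))‖⁻¹ * Real.exp (-c)) ^ r := by gcongr
    _ = ‖Ereg ℓ (Complex.exp (-(t : ℂ)))‖⁻¹ ^ r * Real.exp (-c) ^ r := mul_pow _ _ _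
    _ ≤ _ := by
      gcongr
      exact pow_le_of_le_one (Real.exp_pos _).le (by simpa using hc0) (by omega)

/-- the generating function in exponential coordinates -/
noncomputable def Gf (ℓ r : ℕ) (z : ℂ) : ℂ := (Ereg ℓ (Complex.exp (-z)))⁻¹ ^ r

lemma Gf_hasSum (ℓ r : ℕ) {t : ℝ} (ht : 0 < t) (θ : ℝ) :
    HasSum (fun m => (coloredRegularCount ℓ r m : ℂ) * Complex.exp (-(t + θ * Complex.I)) ^ m)
      (Gf ℓ r (t + θ * Complex.I)) := by
  obtain ⟨h1, h2⟩ := PEval_colored ℓ r (q := Complex.exp (-(t + θ * Complex.I))) (by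
    rw [qnorm]; simpa using ht)
  unfold Gf
  rw [← h2]
  exact h1.of_norm.hasSum

lemma coef_summable (ℓ r : ℕ) {t : ℝ} (ht : 0 < t) :
    Summable (fun m => (coloredRegularCount ℓ r m : ℝ) * Real.exp (-t) ^ m) := by
  obtain ⟨h1, -⟩ := PEval_colored ℓ r (q := Complex.exp (-(t + (0 : ℝ) * Complex.I))) (by
    rw [qnorm]; simpa using ht)
  refine h1.congr fun m => ?_
  rw [norm_mul, norm_pow, qnorm, Complex.norm_natCast]

lemma Gf_cont (ℓ r : ℕ) {t : ℝ} (ht : 0 < t) :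
    Continuous (fun θ : ℝ => Gf ℓ r (t + θ * Complex.I)) := by
  have e : (fun θ : ℝ => Gf ℓ r (t + θ * Complex.I)) = fun θ : ℝ =>
      ∑' m, (coloredRegularCount ℓ r m : ℂ) * Complex.exp (-(t + θ * Complex.I)) ^ m := by
    funext θ
    exact (Gf_hasSum ℓ r ht θ).tsum_eq.symm
  rw [e]
  refine continuous_tsum (fun m => by fun_prop) (coef_summable ℓ r ht) fun m θ => ?_
  rw [norm_mul, norm_pow, qnorm, Complex.norm_natCast]

lemma integral_char (k : ℤ) : ∫ θ in (-Real.pi)..Real.pi, Complex.exp (k * (θ * Complex.I)) =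
    if k = 0 then 2 * Real.pi else 0 := by
  split_ifs with h
  · subst h
    simp
    ring
  · have hc : (k : ℂ) * Complex.I ≠ 0 := by simp [h]
    have := integral_exp_mul_complex (a := -Real.pi) (b := Real.pi) hc
    have e : (fun θ : ℝ => Complex.exp (k * (θ * Complex.I))) = fun θ : ℝ =>
      Complex.exp ((k * Complex.I) * θ) := by
      funext θ; congr 1; ring
    rw [e, this]
    have e2 : Complex.exp (k * Complex.I * (Real.pi : ℝ)) = 
        Complex.exp (k * Complex.I * ((-Real.pi : ℝ) : ℂ)) := by
      rw [Complex.exp_eq_exp_iff_exists_int]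
      exact ⟨k, by push_cast; ring⟩
    rw [e2]; simp

lemma coef_formula (ℓ r n : ℕ) {t : ℝ} (ht : 0 < t) :
    ∫ θ in (-Real.pi)..Real.pi, Gf ℓ r (t + θ * Complex.I) * Complex.exp (n * (t + θ * Complex.I))
      = 2 * Real.pi * (coloredRegularCount ℓ r n : ℂ) := by
  have hs := intervalIntegral.hasSum_integral_of_dominated_convergence (μ := MeasureTheory.volume)
    (a := -Real.pi) (b := Real.pi)
    (F := fun (m : ℕ) (θ : ℝ) => (coloredRegularCount ℓ r m : ℂ) * Complex.exp (-(t + θ * Complex.I)) ^ m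
       * Complex.exp (n * (t + θ * Complex.I)))
    (f := fun θ : ℝ => Gf ℓ r (t + θ * Complex.I) * Complex.exp (n * (t + θ * Complex.I)))
    (fun m _ => (coloredRegularCount ℓ r m : ℝ) * Real.exp (-t) ^ m * Real.exp (n * t))
    (fun m => (by fun_prop : Continuous _).aestronglyMeasurable)
    (fun m => Eventually.of_forall fun θ _ => by
      rw [norm_mul, norm_mul, norm_pow, qnorm, Complex.norm_natCast, Complex.norm_exp]
      simp)
    (Eventually.of_forall fun θ _ => (coef_summable ℓ r ht).mul_right _)
    (by simp)
    (Eventually.of_forall fun θ _ => (Gf_hasSum ℓ r ht θ).mul_right _)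
  have hterm : ∀ m : ℕ, ∫ θ in (-Real.pi)..Real.pi, (coloredRegularCount ℓ r m : ℂ) *
      Complex.exp (-(t + θ * Complex.I)) ^ m * Complex.exp (n * (t + θ * Complex.I)) =
      if m = n then 2 * Real.pi * (coloredRegularCount ℓ r n : ℂ) else 0 := by
    intro m
    have e : (fun θ : ℝ => (coloredRegularCount ℓ r m : ℂ) *
      Complex.exp (-(t + θ * Complex.I)) ^ m * Complex.exp (n * (t + θ * Complex.I))) = 
      fun θ : ℝ => ((coloredRegularCount ℓ r m : ℂ) * Complex.exp (((n - m : ℤ) : ℂ) * t)) *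
        Complex.exp (((n - m : ℤ) : ℂ) * (θ * Complex.I)) := by
      funext θ
      rw [← Complex.exp_nat_mul, mul_assoc, mul_assoc, ← Complex.exp_add, ← Complex.exp_add]
      congr 2
      push_cast; ring
    rw [e, intervalIntegral.integral_const_mul, integral_char]
    by_cases h : m = n
    · subst h; simp; ring
    · have : (n - m : ℤ) ≠ 0 := by omega
      simp [this, h]
  simp only [hterm] at hs
  exact hs.unique (hasSum_ite_eq n _)

/-- saddle exponent constant -/
noncomputable def Ac (ℓ r : ℕ) : ℝ := r * (Real.pi ^ 2 / 6) * (1 - 1 / ℓ)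

lemma Ac_pos (ℓ r : ℕ) (hℓ : 2 ≤ ℓ) (hr : 1 ≤ r) : 0 < Ac ℓ r := by
  unfold Ac
  have : (2 : ℝ) ≤ ℓ := by exact_mod_cast hℓ
  have h2 : (1 : ℝ) ≤ r := by exact_mod_cast hr
  have h3 : 1 / (ℓ : ℝ) ≤ 1 / 2 := one_div_le_one_div_of_le (by norm_num) this
  have := Real.pi_pos
  have : 0 < 1 - 1 / (ℓ : ℝ) := by linarith
  positivity

lemma Rf_eq (ℓ r : ℕ) (z : ℂ) : Rf ℓ r z = Gf ℓ r z * Complex.exp (-((Ac ℓ r : ℝ) / z)) := by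
  unfold Rf Gf Ac
  rfl

lemma Gf_eq (ℓ r : ℕ) (z : ℂ) : Gf ℓ r z = Rf ℓ r z * Complex.exp ((Ac ℓ r : ℝ) / z) := by
  rw [Rf_eq, mul_assoc, ← Complex.exp_add]; simp

/-- normalised integrand -/
noncomputable def Kf (ℓ r n : ℕ) (t M : ℝ) (v : ℝ) : ℂ :=
  Complex.exp (-(2 * (M ^ 2 : ℝ))) * (Gf ℓ r (t + ((t / M) * v : ℝ) * Complex.I) *
    Complex.exp (n * (t + ((t / M) * v : ℝ) * Complex.I)))

lemma Kf_cont (ℓ r n : ℕ) {t : ℝ} (ht : 0 < t) (M : ℝ) : Continuous (Kf ℓ r n t M) := by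
  unfold Kf
  have := (Gf_cont ℓ r ht).comp (by fun_prop : Continuous fun v : ℝ => (t / M) * v)
  exact continuous_const.mul (this.mul (by fun_prop))

lemma one_add_ne (u : ℝ) : (1 : ℂ) + u * Complex.I ≠ 0 := by
  intro h
  have := congrArg Complex.re h
  simp at this

lemma Kf_eq (ℓ r n : ℕ) {t M : ℝ} (ht : 0 < t) (hM : 0 < M) (h1 : n * t = M ^ 2)
    (h2 : Ac ℓ r = M ^ 2 * t) (v : ℝ) :
    Kf ℓ r n t M v = Rf ℓ r (t + ((t / M) * v : ℝ) * Complex.I) *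
      Complex.exp (-(v ^ 2 / (1 + ((v / M : ℝ) : ℂ) * Complex.I))) := by
  unfold Kf
  rw [Gf_eq]
  have hz : (t : ℂ) + ((t / M) * v : ℝ) * Complex.I = t * (1 + ((v / M : ℝ) : ℂ) * Complex.I) := by
    push_cast; ring
  have hw := one_add_ne (v / M)
  have ht' : (t : ℂ) ≠ 0 := by exact_mod_cast ht.ne'
  have hM' : (M : ℂ) ≠ 0 := by exact_mod_cast hM.ne'
  have key : -(2 * ((M ^ 2 : ℝ) : ℂ)) + ((Ac ℓ r : ℝ) / ((t : ℂ) + ((t / M) * v : ℝ) * Complex.I) +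
     n * (t + ((t / M) * v : ℝ) * Complex.I)) = -(v ^ 2 / (1 + ((v / M : ℝ) : ℂ) * Complex.I)) := by
    rw [hz, h2]
    have h1' : (n : ℂ) * t = M ^ 2 := by exact_mod_cast h1
    rw [← mul_assoc, h1']
    have hv : (v : ℂ) = M * ((v / M : ℝ) : ℂ) := by push_cast; field_simp
    rw [hv]
    have hd : ((((M : ℂ) * ((v / M : ℝ) : ℂ)) / M)) = ((v / M : ℝ) : ℂ) := by field_simp
    generalize ((v / M : ℝ) : ℂ) = u at *
    push_cast
    field_simp
    ring_nf
    simp only [Complex.I_sq]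
    ring
  rw [← key, Complex.exp_add, Complex.exp_add]
  ring

lemma major_subst (ℓ r n : ℕ) {t M : ℝ} (ht : 0 < t) (hM : 0 < M) :
    ∫ θ in (-t)..t, Gf ℓ r (t + θ * Complex.I) * Complex.exp (n * (t + θ * Complex.I)) =
     ((t / M * Real.exp (2 * M ^ 2) : ℝ) : ℂ) * ∫ v, (Set.Ioc (-M) M).indicator (Kf ℓ r n t M) v := by
  rw [MeasureTheory.integral_indicator measurableSet_Ioc,
    ← intervalIntegral.integral_of_le (by linarith)]
  unfold Kf
  rw [intervalIntegral.integral_const_mul]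
  have := intervalIntegral.smul_integral_comp_mul_left (a := -M) (b := M) (fun θ : ℝ => Gf ℓ r (t + θ * Complex.I) * Complex.exp (n * (t + θ * Complex.I))) (t / M)
  have e1 : t / M * -M = -t := by field_simp
  have e2 : t / M * M = t := by field_simp
  rw [e1, e2] at this
  rw [← this]
  rw [Complex.real_smul, ← mul_assoc]
  congr 1
  push_cast
  rw [mul_assoc, ← Complex.exp_add]
  simp

lemma mem_cone {t u : ℝ} (ht : 0 < t) (hu : |u| ≤ t) : (t + u * Complex.I : ℂ) ∈ cone := by
  unfold cone
  simp [ht, hu]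

lemma Kexp_norm (u v : ℝ) (hu : |u| ≤ 1) : 
    ‖Complex.exp (-((v : ℂ) ^ 2 / (1 + (u : ℂ) * Complex.I)))‖ ≤ Real.exp (-(1 / 2) * v ^ 2) := by
  rw [Complex.norm_exp]
  apply Real.exp_le_exp.mpr
  have : ((v : ℂ) ^ 2 / (1 + (u : ℂ) * Complex.I)).re = v ^ 2 / (1 + u ^ 2) := by
    rw [← Complex.ofReal_pow, Complex.div_re]
    simp [Complex.normSq_apply]
    have : 1 + u ^ 2 ≠ 0 := by positivity
    rw [← pow_two]
    field_simp
    rw [← Complex.ofReal_pow, Complex.ofReal_re, Complex.ofReal_im]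
    ring
  rw [Complex.neg_re, this]
  have hu2 : u ^ 2 ≤ 1 := by rw [← sq_abs]; exact pow_le_one₀ (abs_nonneg _) hu
  have : v ^ 2 / 2 ≤ v ^ 2 / (1 + u ^ 2) := by
    apply div_le_div_of_nonneg_left (by positivity) (by positivity); linarith
  linarith

lemma major_tendsto (ℓ r : ℕ) (hℓ : 2 ≤ ℓ) (t M : ℕ → ℝ)
    (ht : ∀ᶠ n in atTop, 0 < t n) (hM : ∀ᶠ n in atTop, 0 < M n)
    (h1 : ∀ᶠ n : ℕ in atTop, n * t n = M n ^ 2) (h2 : ∀ᶠ n in atTop, Ac ℓ r = M n ^ 2 * t n)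
    (ht0 : Tendsto t atTop (nhds 0)) (hMt : Tendsto M atTop atTop) :
    Tendsto (fun n => ∫ v, (Set.Ioc (-(M n)) (M n)).indicator (Kf ℓ r n (t n) (M n)) v) atTop
      (nhds ((((Real.sqrt ℓ)⁻¹ ^ r * Real.sqrt Real.pi : ℝ) : ℂ))) := by
  set lam : ℂ := (((Real.sqrt ℓ)⁻¹ ^ r : ℝ) : ℂ) with hlam
  have hR := tendsto_Rf ℓ r (by omega)
  have hgauss : ∫ v : ℝ, lam * ((Real.exp (-1 * v ^ 2) : ℝ) : ℂ) = 
      (((Real.sqrt ℓ)⁻¹ ^ r * Real.sqrt Real.pi : ℝ) : ℂ) := by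
    rw [MeasureTheory.integral_const_mul, integral_complex_ofReal, integral_gaussian]
    simp [hlam]
  rw [← hgauss]
  have hRb : ∃ δ > 0, ∀ z ∈ cone, ‖z‖ < δ → ‖Rf ℓ r z‖ ≤ ‖lam‖ + 1 := by
    have : ∀ᶠ z in nhdsWithin 0 cone, ‖Rf ℓ r z‖ < ‖lam‖ + 1 :=
      hR.norm.eventually_lt_const (by linarith)
    rw [eventually_nhdsWithin_iff, Metric.eventually_nhds_iff] at this
    obtain ⟨δ, hδ, h⟩ := this
    exact ⟨δ, hδ, fun z hz hz2 => (h (by simpa using hz2) hz).le⟩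
  obtain ⟨δ, hδ, hRb⟩ := hRb
  have habs : ∀ (t M v : ℝ), 0 < t → 0 < M → v ∈ Set.Ioc (-M) M → |t / M * v| ≤ t := by
    intro t M v ht hM hv
    have : |v| ≤ M := abs_le.mpr ⟨hv.1.le, hv.2⟩
    rw [abs_mul, abs_of_pos (by positivity)]
    calc t / M * |v| ≤ t / M * M := by gcongr
      _ = t := by field_simp
  have htd : ∀ᶠ n in atTop, t n < δ / 2 := ht0.eventually_lt_const (by linarith)
  refine MeasureTheory.tendsto_integral_filter_of_dominated_convergence
    (fun v => (‖lam‖ + 1) * Real.exp (-(1 / 2) * v ^ 2)) ?_ ?_ ?_ ?_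
  · filter_upwards [ht] with n htn
    exact (Kf_cont ℓ r n htn (M n)).aestronglyMeasurable.indicator measurableSet_Ioc
  · filter_upwards [ht, hM, h1, h2, htd] with n htn hMn h1n h2n htdn
    refine Eventually.of_forall fun v => ?_
    by_cases hv : v ∈ Set.Ioc (-(M n)) (M n)
    · rw [Set.indicator_of_mem hv, Kf_eq ℓ r n htn hMn h1n h2n, norm_mul]
      have ha := habs _ _ v htn hMn hv
      refine mul_le_mul (hRb _ (mem_cone htn ha) ?_) (Kexp_norm _ _ ?_) (norm_nonneg _) (by positivity)
      · calc ‖(t n : ℂ) + ((t n / M n * v : ℝ) : ℂ) * Complex.I‖ ≤ 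
            ‖(t n : ℂ)‖ + ‖((t n / M n * v : ℝ) : ℂ) * Complex.I‖ := norm_add_le _ _
          _ ≤ t n + t n := by
            rw [norm_mul, Complex.norm_I, mul_one, Complex.norm_real, Complex.norm_real,
              Real.norm_eq_abs, Real.norm_eq_abs, abs_of_pos htn]
            gcongr
          _ < δ := by linarith
      · rw [abs_div, abs_of_pos hMn, div_le_one hMn]
        exact abs_le.mpr ⟨hv.1.le, hv.2⟩
    · rw [Set.indicator_of_notMem hv]
      simp; positivity
  · exact (integrable_exp_neg_mul_sq (by norm_num)).const_mul _
  · refine Eventually.of_forall fun v => ?_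
    have hvM : ∀ᶠ n in atTop, |v| < M n := hMt.eventually_gt_atTop _
    have hu : Tendsto (fun n => v / M n) atTop (nhds 0) := hMt.const_div_atTop v
    have hz : Tendsto (fun n => (t n : ℂ) + ((t n / M n * v : ℝ) : ℂ) * Complex.I) atTop
        (nhdsWithin 0 cone) := by
      refine tendsto_nhdsWithin_iff.mpr ⟨?_, ?_⟩
      · have a1 : Tendsto (fun n => (t n : ℂ)) atTop (nhds ((0 : ℝ) : ℂ)) :=
          (Complex.continuous_ofReal.tendsto _).comp ht0
        have a2 : Tendsto (fun n => (((t n * (v / M n)) : ℝ) : ℂ)) atTop (nhds ((0 * 0 : ℝ) : ℂ)) :=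
          (Complex.continuous_ofReal.tendsto _).comp (ht0.mul hu)
        have a3 := a1.add (a2.mul_const Complex.I)
        simp only [mul_zero, Complex.ofReal_zero, zero_mul, add_zero] at a3
        refine a3.congr fun n => ?_
        congr 3
        ring
      · filter_upwards [ht, hM, hvM] with n htn hMn hv
        exact mem_cone htn (habs _ _ v htn hMn ⟨by linarith [neg_abs_le v], by linarith [le_abs_self v]⟩)
    have hE : Tendsto (fun n => Complex.exp (-((v : ℂ) ^ 2 / (1 + ((v / M n : ℝ) : ℂ) * Complex.I)))) atTop
        (nhds ((Real.exp (-1 * v ^ 2) : ℝ) : ℂ)) := by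
      have a1 : Tendsto (fun n => ((v / M n : ℝ) : ℂ)) atTop (nhds ((0 : ℝ) : ℂ)) :=
          (Complex.continuous_ofReal.tendsto _).comp hu
      have a2 : Tendsto (fun n => 1 + ((v / M n : ℝ) : ℂ) * Complex.I) atTop (nhds 1) := by
        simpa using (a1.mul_const Complex.I).const_add 1
      have a3 := (Complex.continuous_exp.tendsto _).comp ((tendsto_const_nhds (x := (v : ℂ) ^ 2)).div a2 one_ne_zero).neg
      have e : ((Real.exp (-1 * v ^ 2) : ℝ) : ℂ) = Complex.exp (-((v : ℂ) ^ 2 / 1)) := by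
        push_cast; congr 1; ring
      rw [e]
      exact a3
    refine ((hR.comp hz).mul hE).congr' ?_
    filter_upwards [ht, hM, h1, h2, hvM] with n htn hMn h1n h2n hv
    rw [Set.indicator_of_mem (show v ∈ Set.Ioc (-(M n)) (M n) from ⟨by linarith [neg_abs_le v], by linarith [le_abs_self v]⟩),
      Kf_eq ℓ r n htn hMn h1n h2n]
    rfl

lemma minor_point (ℓ r n : ℕ) (hℓ : 2 ≤ ℓ) (hr : 1 ≤ r) {t M C θ : ℝ} (ht : 0 < t) 
    (ht2 : t ≤ 1 / (2 * ℓ)) (h1 : n * t = M ^ 2) (h2 : Ac ℓ r = M ^ 2 * t)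
    (hC : ‖Rf ℓ r (t : ℂ)‖ ≤ C) (hθ1 : t ≤ |θ|) (hθ2 : |θ| ≤ Real.pi) :
    ‖Gf ℓ r (t + θ * Complex.I) * Complex.exp (n * (t + θ * Complex.I))‖ ≤
      C * (Real.exp (2 * M ^ 2) * Real.exp (-(1 / (24 * (ℓ : ℝ) ^ 3) / t))) := by
  have hb := minor_bound ℓ r hℓ hr ht ht2 hθ1 hθ2
  have e1 : ‖Gf ℓ r (t : ℂ)‖ = ‖Rf ℓ r (t : ℂ)‖ * Real.exp (M ^ 2) := by
    rw [Gf_eq, norm_mul, ← Complex.ofReal_div, ← Complex.ofReal_exp, Complex.norm_real,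
      Real.norm_of_nonneg (Real.exp_pos _).le, h2]
    congr 2
    field_simp
  have e2 : ‖Complex.exp (n * (t + θ * Complex.I))‖ = Real.exp (M ^ 2) := by
    rw [Complex.norm_exp, ← h1]; simp
  change ‖Gf ℓ r (t + θ * Complex.I)‖ ≤ ‖Gf ℓ r (t : ℂ)‖ * _ at hb
  rw [norm_mul, e2]
  rw [e1] at hb
  have e3 : Real.exp (2 * M ^ 2) = Real.exp (M ^ 2) * Real.exp (M ^ 2) := by
    rw [← Real.exp_add]; congr 1; ring
  calc _ ≤ (‖Rf ℓ r (t : ℂ)‖ * Real.exp (M ^ 2) * Real.exp (-(1 / (24 * (ℓ : ℝ) ^ 3) / t))) * Real.exp (M ^ 2) := by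
        gcongr
    _ ≤ (C * Real.exp (M ^ 2) * Real.exp (-(1 / (24 * (ℓ : ℝ) ^ 3) / t))) * Real.exp (M ^ 2) := by
        gcongr
    _ = _ := by rw [e3]; ring

lemma minor_total (ℓ r n : ℕ) (hℓ : 2 ≤ ℓ) (hr : 1 ≤ r) {t M C : ℝ} (ht : 0 < t) 
    (ht2 : t ≤ 1 / (2 * ℓ)) (h1 : n * t = M ^ 2) (h2 : Ac ℓ r = M ^ 2 * t)
    (hC : ‖Rf ℓ r (t : ℂ)‖ ≤ C) :
    ‖2 * Real.pi * (coloredRegularCount ℓ r n : ℂ) - 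
      ∫ θ in (-t)..t, Gf ℓ r (t + θ * Complex.I) * Complex.exp (n * (t + θ * Complex.I))‖ ≤
      2 * Real.pi * (C * (Real.exp (2 * M ^ 2) * Real.exp (-(1 / (24 * (ℓ : ℝ) ^ 3) / t)))) := by
  rw [← coef_formula ℓ r n ht]
  set f : ℝ → ℂ := fun θ => Gf ℓ r (t + θ * Complex.I) * Complex.exp (n * (t + θ * Complex.I)) with hf
  set B := C * (Real.exp (2 * M ^ 2) * Real.exp (-(1 / (24 * (ℓ : ℝ) ^ 3) / t))) with hB
  have hB0 : 0 ≤ B := by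
    have : 0 ≤ C := (norm_nonneg _).trans hC
    positivity
  have hcont : Continuous f := (Gf_cont ℓ r ht).mul (by fun_prop)
  have hi : ∀ a b : ℝ, IntervalIntegrable f MeasureTheory.volume a b := fun a b => hcont.intervalIntegrable a b
  have hl : (2 : ℝ) ≤ ℓ := by exact_mod_cast hℓ
  have htpi : t ≤ Real.pi := by
    have : 1 / (2 * (ℓ : ℝ)) ≤ 1 := by
      rw [div_le_one (by positivity)]; linarith
    linarith [Real.pi_gt_three]
  have e : (∫ θ in (-Real.pi)..Real.pi, f θ) - ∫ θ in (-t)..t, f θ =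
      (∫ θ in (-Real.pi)..(-t), f θ) + ∫ θ in t..Real.pi, f θ := by
    rw [← intervalIntegral.integral_add_adjacent_intervals (hi (-Real.pi) (-t)) (hi (-t) Real.pi),
      ← intervalIntegral.integral_add_adjacent_intervals (hi (-t) t) (hi t Real.pi)]
    ring
  rw [e]
  have b1 : ‖∫ θ in (-Real.pi)..(-t), f θ‖ ≤ B * |(-t) - (-Real.pi)| := by
    apply intervalIntegral.norm_integral_le_of_norm_le_const
    intro θ hθ
    rw [Set.uIoc_of_le (by linarith)] at hθ
    have : |θ| = -θ := abs_of_nonpos (by linarith [hθ.2])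
    exact minor_point ℓ r n hℓ hr ht ht2 h1 h2 hC (by linarith [hθ.2]) (by linarith [hθ.1])
  have b2 : ‖∫ θ in t..Real.pi, f θ‖ ≤ B * |Real.pi - t| := by
    apply intervalIntegral.norm_integral_le_of_norm_le_const
    intro θ hθ
    rw [Set.uIoc_of_le (by linarith)] at hθ
    have : |θ| = θ := abs_of_nonneg (by linarith [hθ.1])
    exact minor_point ℓ r n hℓ hr ht ht2 h1 h2 hC (by linarith [hθ.1]) (by linarith [hθ.2])
  have e3 : |(-t) - (-Real.pi)| = Real.pi - t := by rw [abs_of_nonneg] <;> linarith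
  rw [e3] at b1
  rw [abs_of_nonneg (by linarith)] at b2
  have := norm_add_le (∫ θ in (-Real.pi)..(-t), f θ) (∫ θ in t..Real.pi, f θ)
  nlinarith [mul_nonneg hB0 ht.le]

lemma main_tendsto (ℓ r : ℕ) (hℓ : 2 ≤ ℓ) (hr : 1 ≤ r) (t M : ℕ → ℝ)
    (ht : ∀ᶠ n in atTop, 0 < t n) (hM : ∀ᶠ n in atTop, 0 < M n)
    (h1 : ∀ᶠ n : ℕ in atTop, n * t n = M n ^ 2) (h2 : ∀ᶠ n in atTop, Ac ℓ r = M n ^ 2 * t n)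
    (ht0 : Tendsto t atTop (nhds 0)) (hMt : Tendsto M atTop atTop) :
    Tendsto (fun n => 2 * Real.pi * (coloredRegularCount ℓ r n : ℝ) / 
       (t n / M n * Real.exp (2 * M n ^ 2))) atTop
      (nhds ((Real.sqrt ℓ)⁻¹ ^ r * Real.sqrt Real.pi)) := by
  have hmaj := major_tendsto ℓ r hℓ t M ht hM h1 h2 ht0 hMt
  have hA := Ac_pos ℓ r hℓ hr
  have hl : (2 : ℝ) ≤ ℓ := by exact_mod_cast hℓ
  have hR := tendsto_Rf ℓ r (by omega)
  set lam : ℂ := (((Real.sqrt ℓ)⁻¹ ^ r : ℝ) : ℂ) with hlam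
  have hz : Tendsto (fun n => (t n : ℂ)) atTop (nhdsWithin 0 cone) := by
    refine tendsto_nhdsWithin_iff.mpr ⟨?_, ?_⟩
    · exact_mod_cast (Complex.continuous_ofReal.tendsto _).comp ht0
    · filter_upwards [ht] with n htn
      simpa using mem_cone htn (u := 0) (by simpa using htn.le)
  have hRb : ∀ᶠ n in atTop, ‖Rf ℓ r (t n : ℂ)‖ < ‖lam‖ + 1 :=
    (hR.comp hz).norm.eventually_lt_const (by linarith)
  have hts : ∀ᶠ n in atTop, t n < 1 / (2 * ℓ) := ht0.eventually_lt_const (by positivity)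
  have hdiff : Tendsto (fun n => ((2 * Real.pi * (coloredRegularCount ℓ r n : ℝ) / 
       (t n / M n * Real.exp (2 * M n ^ 2)) : ℝ) : ℂ) - 
       ∫ v, (Set.Ioc (-(M n)) (M n)).indicator (Kf ℓ r n (t n) (M n)) v) atTop (nhds 0) := by
    set b := 1 / (24 * (ℓ : ℝ) ^ 3) / Ac ℓ r with hb
    have hb0 : 0 < b := by positivity
    have hN : Tendsto (fun n => M n ^ 2) atTop atTop := (tendsto_pow_atTop (by norm_num)).comp hMt
    have hlim := ((tendsto_rpow_mul_exp_neg_mul_atTop_nhds_zero (3 / 2) b hb0).comp hN).const_mul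
      (2 * Real.pi * (‖lam‖ + 1) / Ac ℓ r)
    rw [mul_zero] at hlim
    refine squeeze_zero_norm' ?_ hlim
    filter_upwards [ht, hM, h1, h2, hRb, hts] with n htn hMn h1n h2n hRn htsn
    have hm := minor_total ℓ r n hℓ hr htn htsn.le h1n h2n hRn.le
    rw [major_subst ℓ r n htn hMn] at hm
    set I := ∫ v, (Set.Ioc (-(M n)) (M n)).indicator (Kf ℓ r n (t n) (M n)) v
    set W := t n / M n * Real.exp (2 * M n ^ 2) with hW
    have hW0 : 0 < W := by positivity
    have hW' : (W : ℂ) ≠ 0 := by exact_mod_cast hW0.ne'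
    have e1 : ((2 * Real.pi * (coloredRegularCount ℓ r n : ℝ) / W : ℝ) : ℂ) - I = 
        (2 * Real.pi * (coloredRegularCount ℓ r n : ℂ) - (W : ℂ) * I) / W := by
      push_cast
      field_simp
    rw [e1, norm_div, Complex.norm_real, Real.norm_of_nonneg hW0.le, div_le_iff₀ hW0]
    refine hm.trans (le_of_eq ?_)
    simp only [Function.comp]
    have e2 : (M n ^ 2) ^ ((3 : ℝ) / 2) = M n ^ 3 := by
      rw [← Real.rpow_natCast (M n) 2, ← Real.rpow_mul hMn.le, ← Real.rpow_natCast (M n) 3]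
      norm_num
    have e3 : 1 / (24 * (ℓ : ℝ) ^ 3) / t n = b * M n ^ 2 := by
      rw [hb, h2n]; field_simp
    rw [e2, e3, hW]
    have e4 : -b * M n ^ 2 = -(b * M n ^ 2) := by ring
    rw [e4, h2n]
    field_simp
  have := hdiff.add hmaj
  simp only [sub_add_cancel, zero_add] at this
  have h3 := (Complex.continuous_re.tendsto _).comp this
  simp only [Complex.ofReal_re, Function.comp_def] at h3
  exact h3

/-- The asymptotic formula
`b_ℓ^{(r)}(n) ~ (1/√2)(1/ℓ)^{r/2}((r/24)(1−1/ℓ))^{1/4} n^{−3/4} exp(4π√((nr/24)(1−1/ℓ)))`. -/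
theorem coloredRegularCount_asymptotic (r ℓ : ℕ) (hr : 1 ≤ r) (hℓ : 2 ≤ ℓ) :
    Filter.Tendsto (fun n : ℕ =>
      (coloredRegularCount ℓ r n : ℝ) /
        ((1 / Real.sqrt 2) * ((1 / (ℓ : ℝ)) ^ ((r : ℝ) / 2)) *
          (((r : ℝ) / 24) * (1 - 1 / (ℓ : ℝ))) ^ ((1 : ℝ) / 4) *
          ((n : ℝ) ^ (-(3 : ℝ) / 4)) *
          Real.exp (4 * Real.pi * Real.sqrt (((n : ℝ) * r / 24) * (1 - 1 / (ℓ : ℝ))))))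
      Filter.atTop (nhds 1) := by
  have hA := Ac_pos ℓ r hℓ hr
  set A := Ac ℓ r with hAd
  have hl : (2 : ℝ) ≤ ℓ := by exact_mod_cast hℓ
  have hlp : (0 : ℝ) < ℓ := by linarith
  have hpi := Real.pi_pos
  have hcast : Tendsto (fun n : ℕ => (n : ℝ)) atTop atTop := tendsto_natCast_atTop_atTop
  have hpos : ∀ᶠ n : ℕ in atTop, 0 < (n : ℝ) := hcast.eventually_gt_atTop 0
  have key := main_tendsto ℓ r hℓ hr (fun n => Real.sqrt (A / n)) (fun n => Real.sqrt (Real.sqrt (A * n)))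
    (by filter_upwards [hpos] with n hn; positivity)
    (by filter_upwards [hpos] with n hn; positivity)
    (by
      filter_upwards [hpos] with n hn
      rw [Real.sq_sqrt (by positivity), Real.sqrt_div hA.le, Real.sqrt_mul hA.le]
      nth_rewrite 1 [← Real.mul_self_sqrt hn.le]
      have : 0 < Real.sqrt n := by positivity
      field_simp)
    (by
      filter_upwards [hpos] with n hn
      rw [Real.sq_sqrt (by positivity), Real.sqrt_div hA.le, Real.sqrt_mul hA.le]
      have : 0 < Real.sqrt n := by positivity
      field_simp
      exact (Real.sq_sqrt hA.le).symm)
    (by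
      have := (Real.continuous_sqrt.tendsto _).comp (hcast.const_div_atTop A)
      rw [Real.sqrt_zero] at this
      exact this)
    (Real.tendsto_sqrt_atTop.comp (Real.tendsto_sqrt_atTop.comp (hcast.const_mul_atTop hA)))
  have hlam : 0 < (Real.sqrt ℓ)⁻¹ ^ r * Real.sqrt Real.pi := by positivity
  have key2 := key.div_const ((Real.sqrt ℓ)⁻¹ ^ r * Real.sqrt Real.pi)
  rw [div_self hlam.ne'] at key2
  refine key2.congr' ?_
  filter_upwards [hpos] with n hn
  set D := ((r : ℝ) / 24) * (1 - 1 / (ℓ : ℝ)) with hD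
  have hAD : A = (2 * Real.pi) ^ 2 * D := by
    rw [hAd, hD]; unfold Ac; ring
  have hD0 : 0 < D := by
    by_contra h
    push Not at h
    nlinarith [mul_nonneg (sq_nonneg (2 * Real.pi)) (neg_nonneg.mpr h)]
  have hnD : (n : ℝ) * r / 24 * (1 - 1 / (ℓ : ℝ)) = n * D := by rw [hD]; ring
  rw [hnD, Real.sq_sqrt (by positivity)]
  have eN : Real.sqrt (A * n) = 2 * Real.pi * Real.sqrt (n * D) := by
    rw [hAD, mul_assoc, Real.sqrt_mul (by positivity), Real.sqrt_sq (by positivity), mul_comm D]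
  have eexp : 2 * Real.sqrt (A * n) = 4 * Real.pi * Real.sqrt (n * D) := by rw [eN]; ring
  rw [eexp]
  have elam : (1 / (ℓ : ℝ)) ^ ((r : ℝ) / 2) = (Real.sqrt ℓ)⁻¹ ^ r := by
    rw [← Real.sqrt_inv, Real.sqrt_eq_rpow, ← Real.rpow_natCast, ← Real.rpow_mul (by positivity), one_div]
    congr 1; ring
  have eT : Real.sqrt (A / n) / Real.sqrt (Real.sqrt (A * n)) =
      Real.sqrt (2 * Real.pi) * D ^ ((1 : ℝ) / 4) * (n : ℝ) ^ (-(3 : ℝ) / 4) := by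
    have f1 : A ^ ((1 : ℝ) / 4) = Real.sqrt (2 * Real.pi) * D ^ ((1 : ℝ) / 4) := by
      rw [hAD, Real.mul_rpow (by positivity) hD0.le, ← Real.rpow_natCast (2 * Real.pi) 2,
        ← Real.rpow_mul (by positivity), Real.sqrt_eq_rpow]
      norm_num
    rw [← f1]
    simp only [Real.sqrt_eq_rpow]
    rw [← Real.rpow_mul (by positivity), Real.div_rpow hA.le hn.le, Real.mul_rpow hA.le hn.le,
      div_div, mul_comm, mul_assoc, ← Real.rpow_add hn, ← div_div, ← Real.rpow_sub hA,
      div_eq_mul_inv, ← Real.rpow_neg hn.le]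
    norm_num
  rw [eT, elam]
  have e2 : Real.sqrt (2 * Real.pi) = Real.sqrt 2 * Real.sqrt Real.pi := Real.sqrt_mul (by norm_num) _
  rw [e2]
  have s2 : Real.sqrt 2 ^ 2 = 2 := Real.sq_sqrt (by norm_num)
  have sp : Real.sqrt Real.pi ^ 2 = Real.pi := Real.sq_sqrt hpi.le
  have p1 : 0 < D ^ ((1 : ℝ) / 4) := by positivity
  have p2 : 0 < (n : ℝ) ^ (-(3 : ℝ) / 4) := by positivity
  have p3 := Real.exp_pos (4 * Real.pi * Real.sqrt (n * D))
  have p4 : 0 < (Real.sqrt ℓ)⁻¹ ^ r := by positivity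
  have p5 : 0 < Real.sqrt 2 := by positivity
  have p6 : 0 < Real.sqrt Real.pi := by positivity
  generalize D ^ ((1 : ℝ) / 4) = X1 at *
  generalize (n : ℝ) ^ (-(3 : ℝ) / 4) = X2 at *
  generalize Real.exp (4 * Real.pi * Real.sqrt (n * D)) = X3 at *
  generalize (Real.sqrt ℓ)⁻¹ ^ r = X4 at *
  generalize (coloredRegularCount ℓ r n : ℝ) = X5 at *
  rw [div_div, div_eq_div_iff (by positivity) (by positivity)]
  have q1 : 2 * Real.pi * (1 / Real.sqrt 2) = Real.sqrt 2 * Real.sqrt Real.pi ^ 2 := by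
    rw [sp]; field_simp; rw [s2]
  linear_combination (X5 * X4 * X1 * X2 * X3) * q1
end
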